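/- A block function φ = Σ_{k=0}^n φ_k·φ^n_k on W_{r,n} is a character (i.e., a non-negative integer—or at least non-negative—combination of irreducible characters, equivalently non-negative definite when also normalized appropriately) if and only if φ_k ≥ 0 for all k = 0,...,n. -/

import Mathlib

/-- The wreath product `W_{r,n} = Z_r ≀ S_n`, realized as the semidirect
product `(Z_r)^n ⋊ S_n`. -/
abbrev WreathProduct (r n : ℕ) :=
  SemidirectProduct (Fin n → Multiplicative (ZMod r)) (Equiv.Perm (Fin n))
    mulAutArrow

/-- `ℓ_n(w)`: the number of color-`0` cycles of `w = (σ, x) ∈ W_{r,n}`. -/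
def blockLen (r n : ℕ) (σ : Equiv.Perm (Fin n)) (x : Fin n → ZMod r) : ℕ :=
  (σ.cycleFactorsFinset.filter (fun c => (∑ i ∈ c.support, x i) = 0)).card +
    (Finset.univ.filter (fun i : Fin n => σ i = i ∧ x i = 0)).card

/-- `ℓ_n` on the wreath product. -/
def WreathProduct.len {r n : ℕ} (w : WreathProduct r n) : ℕ :=
  blockLen r n w.right (fun i => Multiplicative.toAdd (w.left i))

/-- The Foulkes character `φ^n_k = ∑_{j=0}^{k} (-1)^j C(n+1,j) χ^n_{k-j}`
of `W_{r,n}`, where `χ^n_i(w) = (ri+1)^{ℓ_n(w)}`. -/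
noncomputable def foulkesChar (r n k : ℕ) (w : WreathProduct r n) : ℂ :=
  ∑ j ∈ Finset.range (k + 1),
    (-1 : ℂ) ^ j * ((n + 1).choose j : ℂ) *
      ((r : ℂ) * (k - j : ℕ) + 1) ^ w.len

/-- A function `G → ℂ` is a character if it is a non-negative (real) linear
combination of characters of irreducible representations of `G`. -/
def IsCharacter (G : Type) [Group G] (f : G → ℂ) : Prop :=
  ∃ (m : ℕ) (V : Fin m → FDRep ℂ G) (c : Fin m → ℝ),
    (∀ i, CategoryTheory.Simple (V i)) ∧ (∀ i, 0 ≤ c i) ∧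
      ∀ g, f g = ∑ i, (c i : ℂ) * (V i).character g

open Module in
theorem IsCharacter.add {G : Type} [Group G] {f g : G → ℂ} (hf : IsCharacter G f)
    (hg : IsCharacter G g) : IsCharacter G (fun x => f x + g x) := by
  obtain ⟨m, V, c, h1, h2, h3⟩ := hf
  obtain ⟨m', V', c', h1', h2', h3'⟩ := hg
  refine ⟨m + m', Fin.append V V', Fin.append c c', ?_, ?_, ?_⟩
  · intro i
    refine Fin.addCases (fun i => ?_) (fun i => ?_) i
    · simpa using h1 i
    · simpa using h1' i
  · intro i
    refine Fin.addCases (fun i => ?_) (fun i => ?_) i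
    · simpa using h2 i
    · simpa using h2' i
  · intro x
    rw [Fin.sum_univ_add]
    simp [h3, h3']

theorem IsCharacter.zero {G : Type} [Group G] : IsCharacter G (fun _ => 0) :=
  ⟨0, Fin.elim0, Fin.elim0, fun i => i.elim0, fun i => i.elim0, by simp⟩

theorem IsCharacter.smul {G : Type} [Group G] {f : G → ℂ} (hf : IsCharacter G f) (a : ℝ)
    (ha : 0 ≤ a) : IsCharacter G (fun x => (a : ℂ) * f x) := by
  obtain ⟨m, V, c, h1, h2, h3⟩ := hf
  refine ⟨m, V, fun i => a * c i, h1, fun i => mul_nonneg ha (h2 i), fun g => ?_⟩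
  simp [h3, Finset.mul_sum, mul_assoc]

theorem IsCharacter.sum {G : Type} [Group G] {ι : Type*} (s : Finset ι) (f : ι → G → ℂ)
    (h : ∀ i ∈ s, IsCharacter G (f i)) : IsCharacter G (fun x => ∑ i ∈ s, f i x) := by
  classical
  induction s using Finset.induction_on with
  | empty => simpa using IsCharacter.zero
  | insert a s ha ih =>
    simp only [Finset.sum_insert ha]
    exact (h a (by simp)).add (ih fun i hi => h i (by simp [hi]))

theorem rep_isCharacter_aux {G : Type} [Group G] [Fintype G] (N : ℕ) : ∀ (V : Type)
    [AddCommGroup V] [Module ℂ V] [FiniteDimensional ℂ V] (ρ : Representation ℂ G V),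
    Module.finrank ℂ V ≤ N → IsCharacter G ρ.character := by
  induction N with
  | zero =>
    intro V _ _ _ ρ h
    have : Subsingleton V := (Module.finrank_zero_iff (R := ℂ)).mp (by omega)
    have h0 : ρ.character = fun _ => 0 := by
      funext g
      have : ρ g = 0 := LinearMap.ext fun v => Subsingleton.elim _ _
      simp [Representation.character, this]
    rw [h0]; exact IsCharacter.zero
  | succ N ih =>
    intro V _ _ _ ρ h
    have inv : Invertible (Nat.card G : ℂ) := invertibleOfNonzero (NeZero.ne _)
    by_cases hirr : ρ.IsIrreducible
    · have ho := Representation.char_orthonormal ρ ρ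
      rw [if_pos ⟨Representation.Equiv.refl ρ⟩] at ho
      have hs : CategoryTheory.Simple (FDRep.of ρ) := by
        rw [FDRep.simple_iff_char_is_norm_one]
        have : ∀ g, (FDRep.of ρ).character g = ρ.character g := fun g => rfl
        simp only [this]
        field_simp at ho
        simpa using ho
      exact ⟨1, fun _ => FDRep.of ρ, fun _ => 1, fun _ => hs, fun _ => zero_le_one,
        fun g => by simp; rfl⟩
    · by_cases hn : Nontrivial V
      · have hnt : Nontrivial (Subrepresentation ρ) := by
          refine ⟨⊥, ⊤, fun hh => ?_⟩
          have := congrArg Subrepresentation.toSubmodule hh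
          exact bot_ne_top (α := Submodule ℂ V) this
        have : ∃ p : Subrepresentation ρ, p ≠ ⊥ ∧ p ≠ ⊤ := by
          by_contra hc
          push Not at hc
          exact hirr ⟨fun a => or_iff_not_imp_left.mpr (hc a)⟩
        obtain ⟨p, hp0, hp1⟩ := this
        obtain ⟨q, hpq⟩ := exists_isCompl p
        have hc : IsCompl p.toSubmodule q.toSubmodule := by
          constructor
          · rw [disjoint_iff]
            exact congrArg Subrepresentation.toSubmodule (disjoint_iff.mp hpq.1)
          · rw [codisjoint_iff]
            exact congrArg Subrepresentation.toSubmodule (codisjoint_iff.mp hpq.2)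
        have hfr := Submodule.finrank_add_eq_of_isCompl hc
        have hp : 0 < Module.finrank ℂ p.toSubmodule := by
          rw [Nat.pos_iff_ne_zero]
          intro h0
          exact hp0 (Subrepresentation.toSubmodule_injective (Submodule.finrank_eq_zero.mp h0))
        have hp' : Module.finrank ℂ p.toSubmodule < Module.finrank ℂ V := by
          refine Submodule.finrank_lt fun h0 => hp1 (Subrepresentation.toSubmodule_injective h0)
        have e : ρ.character = fun g => p.toRepresentation.character g +
            q.toRepresentation.character g := by
          funext g
          have := LinearMap.trace_eq_sum_trace_restrict (R := ℂ) (M := V)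
            (N := fun b : Bool => if b then p.toSubmodule else q.toSubmodule) (f := ρ g)
            ((DirectSum.isInternal_submodule_iff_isCompl _ (i := true) (j := false)
              (by decide) (by ext b; cases b <;> simp)).mpr (by simpa using hc))
            (by
              intro b; cases b
              · exact fun v hv => q.apply_mem_toSubmodule g hv
              · exact fun v hv => p.apply_mem_toSubmodule g hv)
          rw [Fintype.sum_bool] at this
          exact this
        rw [e]
        exact (ih _ p.toRepresentation (by omega)).add (ih _ q.toRepresentation (by omega))
      · rw [not_nontrivial_iff_subsingleton] at hn
        have h0 : ρ.character = fun _ => 0 := by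
          funext g
          have : ρ g = 0 := LinearMap.ext fun v => Subsingleton.elim _ _
          simp [Representation.character, this]
        rw [h0]; exact IsCharacter.zero

theorem rep_isCharacter {G : Type} [Group G] [Fintype G] (V : Type)
    [AddCommGroup V] [Module ℂ V] [FiniteDimensional ℂ V] (ρ : Representation ℂ G V) :
    IsCharacter G ρ.character := rep_isCharacter_aux _ V ρ le_rfl

/-- multiplicities of a linear character of a subgroup are natural numbers -/
theorem rep_mult_nat {G : Type} [Group G] [Fintype G] {V : Type*} [AddCommGroup V] [Module ℂ V]
    [FiniteDimensional ℂ V] (ρ : Representation ℂ G V) (H : Subgroup G) [Fintype H]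
    (ψ : H →* ℂ) : ∃ N : ℕ, ∑ h : H, ρ.character h * ψ h = (Nat.card H : ℂ) * N := by
  have inv : Invertible (Nat.card H : ℂ) := invertibleOfNonzero (NeZero.ne _)
  let τ : Representation ℂ H V :=
    { toFun := fun h => ψ h • ρ h
      map_one' := by simp
      map_mul' := fun a b => by
        ext v
        simp only [map_mul, Subgroup.coe_mul, LinearMap.smul_apply, Module.End.mul_apply, map_smul, mul_smul]
        rw [smul_comm] }
  refine ⟨Module.finrank ℂ (Representation.invariants τ), ?_⟩
  have := Representation.card_inv_mul_sum_char_eq_finrank τ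
  rw [← this, mul_inv_cancel_left₀ (NeZero.ne _)]
  refine Finset.sum_congr rfl fun h _ => ?_
  simp [Representation.character, τ, mul_comm]

theorem IsCharacter.mult_nonneg {G : Type} [Group G] [Fintype G] {f : G → ℂ}
    (hf : IsCharacter G f) (H : Subgroup G) [Fintype H] (ψ : H →* ℂ) :
    ∃ N : ℝ, 0 ≤ N ∧ ∑ h : H, f h * ψ h = N := by
  obtain ⟨m, V, c, -, h2, h3⟩ := hf
  choose N hN using fun i => rep_mult_nat (V i).ρ H ψ
  refine ⟨∑ i, c i * (Nat.card H * N i), Finset.sum_nonneg fun i _ =>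
    mul_nonneg (h2 i) (by positivity), ?_⟩
  simp only [h3, Finset.sum_mul]
  rw [Finset.sum_comm]
  push_cast
  refine Finset.sum_congr rfl fun i _ => ?_
  rw [← hN i, Finset.mul_sum]
  exact Finset.sum_congr rfl fun h _ => mul_assoc _ _ _

set_option linter.unusedSimpArgs false

/-- shift of the color of a (level, color) pair; level zero carries no color -/
def cshift {r : ℕ} (a : ZMod r) (p : ℕ × ZMod r) : ℕ × ZMod r :=
  (p.1, if p.1 = 0 then p.2 else p.2 + a)

theorem cshift_zero {r : ℕ} (p : ℕ × ZMod r) : cshift 0 p = p := by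
  simp [cshift]

theorem cshift_cshift {r : ℕ} (a b : ZMod r) (p : ℕ × ZMod r) :
    cshift a (cshift b p) = cshift (b + a) p := by
  by_cases h : p.1 = 0 <;> simp [cshift, h, add_assoc]

/-- the color map of a group element -/
def WreathProduct.col {r n : ℕ} (w : WreathProduct r n) (e : Fin n) : ZMod r :=
  Multiplicative.toAdd (w.left e)

/-- configurations -/
def Cfg (r n : ℕ) := Fin n → ℕ × ZMod r

instance (r n : ℕ) : DecidableEq (Cfg r n) := inferInstanceAs (DecidableEq (Fin n → ℕ × ZMod r))

theorem WreathProduct.col_mul {r n : ℕ} (g h : WreathProduct r n) (e : Fin n) :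
    (g * h).col e = g.col e + h.col (g.right⁻¹ e) := by
  simp [WreathProduct.col, mulAutArrow, MulAut.conj]
  rfl

theorem WreathProduct.col_one {r n : ℕ} (e : Fin n) :
    (1 : WreathProduct r n).col e = 0 := by
  simp [WreathProduct.col]

instance (r n : ℕ) : MulAction (WreathProduct r n) (Cfg r n) where
  smul g f := fun e => cshift (g.col e) (f (g.right⁻¹ e))
  one_smul f := by
    funext e
    change cshift ((1 : WreathProduct r n).col e) (f _) = _
    rw [WreathProduct.col_one, cshift_zero]; simp
  mul_smul g h f := by
    funext e
    change cshift ((g * h).col e) (f _) = cshift (g.col e) (cshift _ (f _))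
    rw [WreathProduct.col_mul, cshift_cshift, add_comm]
    simp

theorem smul_cfg {r n : ℕ} (g : WreathProduct r n) (f : Cfg r n) (e : Fin n) :
    (g • f) e = cshift (g.col e) (f (g.right⁻¹ e)) := rfl

/-- the alphabet with `i` colored levels -/
def Xs (r i : ℕ) [NeZero r] : Finset (ℕ × ZMod r) :=
  insert (0, 0) (Finset.Icc 1 i ×ˢ Finset.univ)

theorem mem_Xs {r i : ℕ} [NeZero r] (p : ℕ × ZMod r) :
    p ∈ Xs r i ↔ p.1 ≤ i ∧ (p.1 = 0 → p.2 = 0) := by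
  obtain ⟨a, b⟩ := p
  simp only [Xs, Finset.mem_insert, Prod.mk.injEq, Finset.mem_product, Finset.mem_Icc,
    Finset.mem_univ, and_true]
  grind

theorem card_Xs (r i : ℕ) [NeZero r] : (Xs r i).card = r * i + 1 := by
  rw [Xs, Finset.card_insert_of_notMem (by simp)]
  simp [ZMod.card, mul_comm]

theorem cshift_mem {r i : ℕ} [NeZero r] (a : ZMod r) (p : ℕ × ZMod r) (h : p ∈ Xs r i) :
    cshift a p ∈ Xs r i := by
  rw [mem_Xs] at *
  simp only [cshift]
  grind

theorem card_Xs_fixed (r i : ℕ) [NeZero r] (s : ZMod r) :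
    ((Xs r i).filter (fun p => cshift s p = p)).card = if s = 0 then r * i + 1 else 1 := by
  split_ifs with h
  · subst h
    rw [← card_Xs r i, Finset.filter_true_of_mem]
    intro p _; exact cshift_zero p
  · rw [Finset.card_eq_one]
    refine ⟨(0, 0), ?_⟩
    ext p
    obtain ⟨a, b⟩ := p
    rw [Finset.mem_filter, mem_Xs, Finset.mem_singleton]
    simp only [cshift, Prod.mk.injEq]
    by_cases ha : a = 0 <;> simp [ha, h]

/-- configurations with values in `Xs r i` -/
def Om (r n i : ℕ) [NeZero r] : Finset (Cfg r n) := Fintype.piFinset (fun _ => Xs r i)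

theorem mem_Om {r n i : ℕ} [NeZero r] (f : Cfg r n) : f ∈ Om r n i ↔ ∀ e, f e ∈ Xs r i := by
  exact Fintype.mem_piFinset

theorem smul_mem_Om {r n i : ℕ} [NeZero r] (g : WreathProduct r n) (f : Cfg r n)
    (h : f ∈ Om r n i) : g • f ∈ Om r n i := by
  rw [mem_Om] at *
  intro e
  rw [smul_cfg]; exact cshift_mem _ _ (h _)

open Classical in
/-- locally fixed configurations on an invariant set -/
noncomputable def Fx {r n : ℕ} [NeZero r] (σ : Equiv.Perm (Fin n)) (x : Fin n → ZMod r) (i : ℕ)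
    (S : Finset (Fin n)) : Finset (Cfg r n) :=
  (Om r n i).filter (fun f => (∀ e ∈ S, f (σ e) = cshift (x (σ e)) (f e)) ∧
    ∀ e, e ∉ S → f e = (0, 0))

theorem mem_Fx {r n : ℕ} [NeZero r] (σ : Equiv.Perm (Fin n)) (x : Fin n → ZMod r) (i : ℕ)
    (S : Finset (Fin n)) (f : Cfg r n) : f ∈ Fx σ x i S ↔ (∀ e, f e ∈ Xs r i) ∧
      (∀ e ∈ S, f (σ e) = cshift (x (σ e)) (f e)) ∧ ∀ e, e ∉ S → f e = (0, 0) := by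
  simp only [Fx, Finset.mem_filter, mem_Om]

theorem Fx_union {r n : ℕ} [NeZero r] (σ : Equiv.Perm (Fin n)) (x : Fin n → ZMod r) (i : ℕ)
    (S T : Finset (Fin n)) (hST : Disjoint S T) (hS : ∀ e, e ∈ S ↔ σ e ∈ S)
    (hT : ∀ e, e ∈ T ↔ σ e ∈ T) :
    (Fx σ x i (S ∪ T)).card = (Fx σ x i S).card * (Fx σ x i T).card := by
  have hd : ∀ e, e ∈ S → e ∉ T := fun e h h' => (Finset.disjoint_left.mp hST) h h'
  have h00 : ((0, 0) : ℕ × ZMod r) ∈ Xs r i := by simp [mem_Xs]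
  rw [← Finset.card_product]
  refine Finset.card_nbij'
    (fun f => ((fun e => if e ∈ S then f e else (0, 0) : Cfg r n),
      (fun e => if e ∈ T then f e else (0, 0) : Cfg r n)))
    (fun p => (fun e => if e ∈ S then p.1 e else p.2 e : Cfg r n)) ?_ ?_ ?_ ?_
  · intro f hf
    simp only [Fx, Finset.coe_filter, Set.mem_ofPred_eq, mem_Om, Finset.coe_product, Set.mem_prod,
      Finset.mem_union] at hf ⊢
    obtain ⟨h1, h2, h3⟩ := hf
    refine ⟨⟨?_, ?_, ?_⟩, ?_, ?_, ?_⟩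
    · intro e; by_cases h : e ∈ S <;> simp [h, h1, h00]
    · intro e he
      simp [he, (hS e).mp he, h2 e (Or.inl he)]
    · intro e he; simp [he]
    · intro e; by_cases h : e ∈ T <;> simp [h, h1, h00]
    · intro e he
      simp [he, (hT e).mp he, h2 e (Or.inr he)]
    · intro e he; simp [he]
  · rintro ⟨f, f'⟩ hf
    simp only [Fx, Finset.coe_filter, Set.mem_ofPred_eq, mem_Om, Finset.coe_product, Set.mem_prod,
      Finset.mem_union] at hf ⊢
    obtain ⟨⟨h1, h2, h3⟩, h1', h2', h3'⟩ := hf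
    refine ⟨?_, ?_, ?_⟩
    · intro e; by_cases h : e ∈ S <;> simp [h, h1, h1']
    · intro e he
      by_cases h : e ∈ S
      · simp [h, (hS e).mp h, h2 e h]
      · have : σ e ∉ S := fun h' => h ((hS e).mpr h')
        simp [h, this, h2' e (he.resolve_left h)]
    · intro e he
      have h4 : e ∉ S := fun h => he (Or.inl h)
      have h5 : e ∉ T := fun h => he (Or.inr h)
      simp [h4, h3' e h5]
  · intro f hf
    simp only [Fx, Finset.coe_filter, Set.mem_ofPred_eq, Finset.mem_union] at hf
    funext e
    by_cases h : e ∈ S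
    · simp [h]
    · by_cases h' : e ∈ T
      · simp [h, h']
      · simp [h, h', hf.2.2 e (by tauto)]
  · rintro ⟨f, f'⟩ hf
    simp only [Fx, Finset.coe_filter, Set.mem_ofPred_eq, mem_Om, Finset.coe_product, Set.mem_prod]
      at hf
    obtain ⟨⟨h1, h2, h3⟩, h1', h2', h3'⟩ := hf
    refine Prod.ext ?_ ?_
    · funext e
      by_cases h : e ∈ S
      · simp [h]
      · simp [h, h3 e h]
    · funext e
      by_cases h : e ∈ T
      · have : e ∉ S := fun h' => hd e h' h
        simp [h, this]
      · simp [h, h3' e h]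

theorem Fx_biUnion {r n : ℕ} [NeZero r] {ι : Type*} [DecidableEq ι] (σ : Equiv.Perm (Fin n))
    (x : Fin n → ZMod r) (i : ℕ)
    (I : Finset ι) (S : ι → Finset (Fin n))
    (hd : ∀ a ∈ I, ∀ b ∈ I, a ≠ b → Disjoint (S a) (S b))
    (hS : ∀ a ∈ I, ∀ e, e ∈ S a ↔ σ e ∈ S a) :
    (Fx σ x i (I.biUnion S)).card = ∏ a ∈ I, (Fx σ x i (S a)).card := by
  induction I using Finset.induction_on with
  | empty =>
    simp only [Finset.biUnion_empty, Finset.prod_empty]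
    rw [Finset.card_eq_one]
    refine ⟨fun _ => (0, 0), ?_⟩
    ext f
    rw [mem_Fx]
    refine Iff.trans ?_ (Finset.mem_singleton (a := (fun _ => (0, 0) : Cfg r n))).symm
    constructor
    · rintro ⟨-, -, h⟩
      funext e
      exact h e (by simp)
    · rintro rfl
      exact ⟨fun e => by simp [mem_Xs], by simp, by simp⟩
  | insert a I ha ih =>
    rw [Finset.biUnion_insert, Finset.prod_insert ha, Fx_union, ih]
    · intro b hb c hc hbc
      exact hd b (by simp [hb]) c (by simp [hc]) hbc
    · intro b hb
      exact hS b (by simp [hb])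
    · rw [Finset.disjoint_biUnion_right]
      intro b hb
      exact hd a (by simp) b (by simp [hb]) (fun h => ha (h ▸ hb))
    · exact hS a (by simp)
    · intro e
      simp only [Finset.mem_biUnion]
      constructor
      · rintro ⟨b, hb, h⟩; exact ⟨b, hb, (hS b (by simp [hb]) e).mp h⟩
      · rintro ⟨b, hb, h⟩; exact ⟨b, hb, (hS b (by simp [hb]) e).mpr h⟩

theorem Fx_orbit {r n : ℕ} [NeZero r] (σ : Equiv.Perm (Fin n)) (x : Fin n → ZMod r) (i : ℕ)
    (S : Finset (Fin n)) (a : Fin n) (N : ℕ) (hN : 0 < N)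
    (hinj : ∀ k < N, ∀ k' < N, (σ ^ k) a = (σ ^ k') a → k = k') (hper : (σ ^ N) a = a)
    (hS : S = (Finset.range N).image (fun k => (σ ^ k) a)) :
    (Fx σ x i S).card = if ∑ e ∈ S, x e = 0 then r * i + 1 else 1 := by
  set P : ℕ → ZMod r := fun k => ∑ t ∈ Finset.range k, x ((σ ^ (t + 1)) a) with hP
  have hsucc : ∀ k, (σ ^ (k + 1)) a = σ ((σ ^ k) a) := fun k => by
    rw [pow_succ', Equiv.Perm.mul_apply]
  have hsum : ∑ e ∈ S, x e = P N := by
    rw [hS, Finset.sum_image (fun k hk k' hk' h => hinj k (by simpa using hk) k'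
      (by simpa using hk') h), hP]
    obtain ⟨M, rfl⟩ : ∃ M, N = M + 1 := ⟨N - 1, by omega⟩
    rw [Finset.sum_range_succ' (fun k => x ((σ ^ k) a)),
      pow_zero, Equiv.Perm.one_apply]
    show _ = ∑ t ∈ Finset.range (M + 1), x ((σ ^ (t + 1)) a)
    rw [Finset.sum_range_succ (fun k => x ((σ ^ (k + 1)) a)), hper]
  have hmem : ∀ k < N, (σ ^ k) a ∈ S := fun k hk => by
    rw [hS]; exact Finset.mem_image_of_mem _ (by simpa using hk)
  rw [← card_Xs_fixed, hsum]
  have key : ∀ f ∈ Fx σ x i S, ∀ k ≤ N, f ((σ ^ k) a) = cshift (P k) (f a) := by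
    intro f hf k
    simp only [Fx, Finset.mem_filter] at hf
    induction k with
    | zero => intro _; simp [hP, cshift_zero]
    | succ k ih =>
      intro hk
      rw [hsucc, hf.2.1 _ (hmem k (by omega)), ih (by omega), cshift_cshift, ← hsucc]
      congr 1
      simp [hP, Finset.sum_range_succ]
  refine Finset.card_bij (fun f _ => f a) ?_ ?_ ?_
  · intro f hf
    have h := key f hf N le_rfl
    rw [hper] at h
    simp only [Fx, Finset.mem_filter, mem_Om] at hf
    simp only [Finset.mem_filter]
    exact ⟨hf.1 a, h.symm⟩
  · intro f hf f' hf' h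
    have h1 := key f hf
    have h1' := key f' hf'
    simp only [Fx, Finset.mem_filter] at hf hf'
    funext e
    by_cases he : e ∈ S
    · rw [hS] at he
      obtain ⟨k, hk, rfl⟩ := Finset.mem_image.mp he
      have hk' : k ≤ N := by have := Finset.mem_range.mp hk; omega
      rw [h1 k hk', h1' k hk', h]
    · rw [hf.2.2 e he, hf'.2.2 e he]
  · intro p hp
    simp only [Finset.mem_filter] at hp
    have hex : ∀ e ∈ S, ∃ k < N, (σ ^ k) a = e := by
      intro e he
      rw [hS] at he
      obtain ⟨k, hk, rfl⟩ := Finset.mem_image.mp he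
      exact ⟨k, by simpa using hk, rfl⟩
    choose! κ hκ1 hκ2 using hex
    have hκ : ∀ k < N, κ ((σ ^ k) a) = k := fun k hk =>
      hinj _ (hκ1 _ (hmem k hk)) k hk (hκ2 _ (hmem k hk))
    refine ⟨fun e => if e ∈ S then cshift (P (κ e)) p else (0, 0), ?_, ?_⟩
    · refine (mem_Fx _ _ _ _ _).mpr ⟨?_, ?_, ?_⟩
      · intro e
        split_ifs
        · exact cshift_mem _ _ hp.1
        · simp [mem_Xs]
      · intro e he
        obtain ⟨k, hk, rfl⟩ : ∃ k < N, (σ ^ k) a = e := ⟨κ e, hκ1 e he, hκ2 e he⟩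
        rw [if_pos he, hκ k hk, ← hsucc, cshift_cshift]
        have hPs : P k + x ((σ ^ (k + 1)) a) = P (k + 1) := by
          simp [hP, Finset.sum_range_succ]
        rw [hPs]
        by_cases hk1 : k + 1 < N
        · rw [if_pos (hmem _ hk1), hκ _ hk1]
        · have : k + 1 = N := by omega
          have h0 := hκ 0 hN
          have h0' := hmem 0 hN
          simp only [pow_zero, Equiv.Perm.one_apply] at h0 h0'
          rw [this, hper, if_pos h0', h0, hp.2]
          simp [hP, cshift_zero]
      · intro e he; simp [he]
    · have h0 := hκ 0 hN
      have h0' := hmem 0 hN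
      simp only [pow_zero, Equiv.Perm.one_apply] at h0 h0'
      simp [h0, h0', hP, cshift_zero]

theorem card_fixed {r n : ℕ} [NeZero r] (i : ℕ) (g : WreathProduct r n) :
    ((Om r n i).filter (fun f => g • f = f)).card = (r * i + 1) ^ g.len := by
  set σ := g.right with hσ
  set x := g.col with hx
  have h1 : (Om r n i).filter (fun f => g • f = f) = Fx σ x i Finset.univ := by
    ext f
    simp only [Fx, Finset.mem_filter, Finset.mem_univ, true_imp_iff, not_true_eq_false,
      false_imp_iff, implies_true, and_true]
    refine and_congr_right fun _ => ⟨fun h e => ?_, fun h => ?_⟩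
    · conv_lhs => rw [← h]
      rw [smul_cfg]; simp [hσ, hx]
    · funext e
      have := h (σ⁻¹ e)
      rw [smul_cfg, ← hσ, ← hx]
      simpa using this.symm
  have h2 : (Finset.univ : Finset (Fin n)) =
      (σ.cycleFactorsFinset.biUnion Equiv.Perm.support) ∪
      (Finset.univ.filter (fun e => σ e = e)).biUnion (fun e => {e}) := by
    ext e
    simp only [Finset.mem_univ, Finset.mem_union, Finset.mem_biUnion, Finset.mem_filter,
      Finset.mem_singleton, true_and, true_iff]
    by_cases h : σ e = e
    · exact Or.inr ⟨e, h, rfl⟩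
    · exact Or.inl ⟨σ.cycleOf e, Equiv.Perm.cycleOf_mem_cycleFactorsFinset_iff.mpr (by simpa using h),
        by simpa [Equiv.Perm.mem_support_cycleOf_iff] using h⟩
  have hA : ∀ c ∈ σ.cycleFactorsFinset, ∀ e, e ∈ c.support ↔ σ e ∈ c.support := by
    intro c hc e
    exact (Equiv.Perm.mem_cycleFactorsFinset_support hc e).symm
  have hB : ∀ a ∈ Finset.univ.filter (fun e => σ e = e), ∀ e, e ∈ ({a} : Finset (Fin n)) ↔
      σ e ∈ ({a} : Finset (Fin n)) := by
    intro a ha e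
    simp only [Finset.mem_filter, Finset.mem_univ, true_and] at ha
    simp only [Finset.mem_singleton]
    constructor
    · rintro rfl; exact ha
    · intro h; exact σ.injective (h.trans ha.symm)
  have hC : ∀ c ∈ σ.cycleFactorsFinset, (Fx σ x i c.support).card =
      if ∑ e ∈ c.support, x e = 0 then r * i + 1 else 1 := by
    intro c hc
    have hcyc := (Equiv.Perm.mem_cycleFactorsFinset_iff.mp hc).1
    obtain ⟨a, ha⟩ := hcyc.nonempty_support
    have hpw : ∀ k : ℕ, (σ ^ k) a = (c ^ k) a := by
      intro k
      induction k with
      | zero => rfl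
      | succ k ih =>
        rw [pow_succ', pow_succ', Equiv.Perm.mul_apply, Equiv.Perm.mul_apply, ih]
        exact ((Equiv.Perm.mem_cycleFactorsFinset_iff.mp hc).2 _
          ((Equiv.Perm.pow_apply_mem_support).mpr ha)).symm
    refine Fx_orbit σ x i c.support a (orderOf c) (orderOf_pos c) ?_ ?_ ?_
    · intro k hk k' hk' h
      rw [hpw, hpw] at h
      have : c ^ k = c ^ k' := (hcyc.pow_eq_pow_iff).mpr ⟨a, by simpa using ha, h⟩
      exact pow_injOn_Iio_orderOf hk hk' this
    · rw [hpw, pow_orderOf_eq_one]; rfl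
    · ext e
      simp only [Finset.mem_image, Finset.mem_range]
      constructor
      · intro he
        obtain ⟨k, hk, h⟩ := (hcyc.sameCycle (by simpa using ha) (by simpa using he)).exists_pow_eq'
        exact ⟨k, hk, by rw [hpw, h]⟩
      · rintro ⟨k, hk, rfl⟩
        rw [hpw]
        exact (Equiv.Perm.pow_apply_mem_support).mpr ha
  have hD : ∀ a ∈ Finset.univ.filter (fun e => σ e = e), (Fx σ x i {a}).card =
      if x a = 0 then r * i + 1 else 1 := by
    intro a ha
    simp only [Finset.mem_filter, Finset.mem_univ, true_and] at ha
    rw [Fx_orbit σ x i {a} a 1 one_pos (by intros; omega) (by simpa using ha) (by simp)]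
    simp
  rw [h1, h2, Fx_union, Fx_biUnion, Fx_biUnion, Finset.prod_congr rfl hC, Finset.prod_congr rfl hD,
    Finset.prod_ite, Finset.prod_ite]
  · simp only [Finset.prod_const, one_pow, mul_one, Finset.prod_const_one]
    rw [← pow_add]
    congr 1
    rw [WreathProduct.len, blockLen, Finset.filter_filter]
    rfl
  · intro a _ b _ hab; simpa using hab
  · exact hB
  · intro a ha b hb hab
    exact (Equiv.Perm.cycleFactorsFinset_pairwise_disjoint σ ha hb hab).disjoint_support
  · exact hA
  · rw [Finset.disjoint_left]
    intro e he he'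
    simp only [Finset.mem_biUnion, Finset.mem_filter, Finset.mem_univ, true_and,
      Finset.mem_singleton] at he he'
    obtain ⟨c, hc, h⟩ := he
    obtain ⟨_, h', rfl⟩ := he'
    have := (Equiv.Perm.mem_cycleFactorsFinset_support_le hc) h
    simp [h'] at this
  · intro e
    simp only [Finset.mem_biUnion]
    constructor
    · rintro ⟨b, hb, h⟩; exact ⟨b, hb, (hA b hb e).mp h⟩
    · rintro ⟨b, hb, h⟩; exact ⟨b, hb, (hA b hb e).mpr h⟩
  · intro e
    simp only [Finset.mem_biUnion]
    constructor
    · rintro ⟨b, hb, h⟩; exact ⟨b, hb, (hB b hb e).mp h⟩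
    · rintro ⟨b, hb, h⟩; exact ⟨b, hb, (hB b hb e).mpr h⟩


/-- a unitriangular family of functions is linearly independent -/
theorem tri_li {ι K : Type*} [Finite ι] [LinearOrder K] (key : ι → K)
    (hk : Function.Injective key) (M : ι → ι → ℂ) (h1 : ∀ w, M w w = 1)
    (h2 : ∀ w v, M w v ≠ 0 → key w ≤ key v) : LinearIndependent ℂ M := by
  classical
  have := Fintype.ofFinite ι
  rw [Fintype.linearIndependent_iff]
  intro c hc
  by_contra hne
  push Not at hne
  obtain ⟨v, hv, hmin⟩ := Finset.exists_min_image (Finset.univ.filter (fun w => c w ≠ 0)) key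
    (by obtain ⟨w, hw⟩ := hne; exact ⟨w, by simpa using hw⟩)
  have hv' : c v ≠ 0 := by simpa using hv
  have := congrFun hc v
  simp only [Finset.sum_apply, Pi.smul_apply, smul_eq_mul, Pi.zero_apply] at this
  rw [Finset.sum_eq_single v] at this
  · simp [h1, hv'] at this
  · intro w _ hwv
    by_contra hz
    have hcw : c w ≠ 0 := left_ne_zero_of_mul hz
    have hM : M w v ≠ 0 := right_ne_zero_of_mul hz
    exact hwv (hk (le_antisymm (h2 w v hM) (hmin w (by simpa using hcw))))
  · simp

/-- abstract descent decomposition of the regular representation -/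
theorem descent_chars {G : Type} [Group G] [Fintype G] {ι K : Type} [Fintype ι] [DecidableEq ι]
    [LinearOrder K] (Des : G → Finset ι) (P : Finset ι → Subgroup G)
    (hP : ∀ D D', D ⊆ D' → P D' ≤ P D) (key : G → K) (hk : Function.Injective key)
    (hT : ∀ D w p, Des w ⊆ D → p ∈ P D → key w ≤ key (w * p))
    (hE : ∀ D v, ∃ p ∈ P D, Des (v * p) ⊆ D) :
    ∃ β : Finset ι → G → ℂ, (∀ D, IsCharacter G (β D)) ∧ ∀ D g,
      (Nat.card (P D) : ℂ) * ∑ E ∈ D.powerset, β E g =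
        (Nat.card {v : G // v⁻¹ * g * v ∈ P D} : ℂ) := by
  classical
  let M : G → G → ℂ := fun w v => if w⁻¹ * v ∈ P (Des w) then 1 else 0
  have hM1 : ∀ w, M w w = 1 := fun w => by simp [M]
  have hM2 : ∀ w v, M w v ≠ 0 → key w ≤ key v := by
    intro w v h
    have h' : w⁻¹ * v ∈ P (Des w) := by
      by_contra hc; simp [M, hc] at h
    simpa using hT (Des w) w _ subset_rfl h'
  have hMP : ∀ D w, Des w ⊆ D → ∀ v, ∀ p ∈ P D, M w (v * p) = M w v := by
    intro D w hw v p hp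
    have hp' : p ∈ P (Des w) := hP _ _ hw hp
    simp only [M, ← mul_assoc]
    rw [Subgroup.mul_mem_cancel_right _ hp']
  have hli := tri_li key hk M hM1 hM2
  let b : Module.Basis G ℂ (G → ℂ) := basisOfLinearIndependentOfCardEqFinrank hli (by simp)
  have hb : ∀ w, b w = M w := fun w => by simp [b]
  -- support property
  have hsupp : ∀ D (F : G → ℂ), (∀ v, ∀ p ∈ P D, F (v * p) = F v) →
      ∀ w, ¬ Des w ⊆ D → b.repr F w = 0 := by
    intro D F hF w hw
    let S := {w : G // Des w ⊆ D}
    let M' : S → S → ℂ := fun w v => M w v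
    have hli' : LinearIndependent ℂ M' := tri_li (fun w : S => key w)
      (fun a b h => Subtype.ext (hk h)) M' (fun w => hM1 w) (fun w v => hM2 w v)
    have : Nonempty S := by
      obtain ⟨p, -, hs⟩ := hE D 1
      exact ⟨⟨_, hs⟩⟩
    let b' : Module.Basis S ℂ (S → ℂ) := basisOfLinearIndependentOfCardEqFinrank hli' (by simp)
    have hb' : ∀ w, b' w = M' w := fun w => by simp [b']
    have hrep := b'.sum_repr (fun s : S => F s)
    set c := b'.repr (fun s : S => F s)
    have hFeq : F = ∑ s : S, c s • b s := by
      funext v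
      obtain ⟨p, hp, hs⟩ := hE D v
      rw [← hF v p hp]
      have := congrFun hrep ⟨v * p, hs⟩
      simp only [Finset.sum_apply, Pi.smul_apply, hb', hb, M'] at this ⊢
      rw [← this]
      refine Finset.sum_congr rfl fun s _ => ?_
      rw [hMP D s s.2 v p hp]
    rw [hFeq]
    simp only [map_sum, map_smul, Module.Basis.repr_self, Finsupp.coe_finsetSum, Finset.sum_apply,
      Finsupp.smul_apply]
    refine Finset.sum_eq_zero fun s _ => ?_
    have hsw : (s : G) ≠ w := fun h => hw (h ▸ s.2)
    rw [Finsupp.single_apply, if_neg hsw]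
    simp
  -- translation operators
  let T : G → (G → ℂ) →ₗ[ℂ] (G → ℂ) := fun g => LinearMap.funLeft ℂ ℂ (fun v => g⁻¹ * v)
  have hTa : ∀ g F v, T g F v = F (g⁻¹ * v) := fun g F v => rfl
  have hTm : ∀ g h F, T (g * h) F = T g (T h F) := by
    intro g h F; funext v; simp [hTa, mul_assoc]
  have hT1 : ∀ F, T 1 F = F := by intro F; funext v; simp [hTa]
  have hTs : ∀ g w u, b.repr (T g (b w)) u ≠ 0 → Des u ⊆ Des w := by
    intro g w u h
    by_contra hc
    refine h (hsupp (Des w) _ ?_ u hc)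
    intro v p hp
    rw [hTa, hTa, hb, ← mul_assoc, hMP (Des w) w subset_rfl _ p hp]
  let γ : G → G → ℂ := fun g w => b.repr (T g (b w)) w
  let A : (D : Finset ι) → G → Matrix {w : G // Des w = D} {w : G // Des w = D} ℂ :=
    fun D g => Matrix.of fun u w => b.repr (T g (b w)) u
  have hA1 : ∀ D, A D 1 = 1 := by
    intro D
    ext u w
    simp only [A, Matrix.of_apply, hT1, Module.Basis.repr_self, Finsupp.single_apply,
      Matrix.one_apply, Subtype.ext_iff]
    simp [eq_comm]
  have hAm : ∀ D g h, A D (g * h) = A D g * A D h := by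
    intro D g h
    ext u w
    rw [Matrix.mul_apply]
    simp only [A, Matrix.of_apply, hTm]
    conv_lhs => rw [← b.sum_repr (T h (b w))]
    simp only [map_sum, map_smul, Finsupp.coe_finsetSum, Finset.sum_apply, Finsupp.smul_apply,
      smul_eq_mul]
    rw [← Fintype.sum_subtype_add_sum_subtype (fun x => Des x = D)]
    rw [Finset.sum_eq_zero (s := (Finset.univ : Finset {x : G // ¬ Des x = D})), add_zero]
    · exact Finset.sum_congr rfl fun x _ => mul_comm _ _
    · intro x _
      by_contra hz
      have h1 := hTs h w x (left_ne_zero_of_mul hz)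
      have h2 := hTs g x u (right_ne_zero_of_mul hz)
      rw [w.2] at h1
      rw [u.2] at h2
      exact x.2 (Finset.Subset.antisymm h1 h2)
  let ρ : (D : Finset ι) → Representation ℂ G ({w : G // Des w = D} → ℂ) := fun D =>
    { toFun := fun g => Matrix.toLin' (A D g)
      map_one' := by rw [hA1]; exact Matrix.toLin'_one
      map_mul' := fun g h => by rw [hAm]; exact Matrix.toLin'_mul _ _ }
  refine ⟨fun D g => ∑ w ∈ Finset.univ.filter (fun w => Des w = D), γ g w, ?_, ?_⟩
  · intro D
    have hc := rep_isCharacter _ (ρ D)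
    have : (ρ D).character = fun g => ∑ w ∈ Finset.univ.filter (fun w => Des w = D), γ g w := by
      funext g
      have h1 : (ρ D).character g = LinearMap.trace ℂ _ (Matrix.toLin' (A D g)) := rfl
      rw [h1, Matrix.trace_toLin'_eq, Matrix.trace]
      rw [← Finset.sum_subtype_eq_sum_filter]
      simp only [Finset.subtype_univ]
      rfl
    show IsCharacter G (fun g => ∑ w ∈ Finset.univ.filter (fun w => Des w = D), γ g w)
    rw [← this]; exact hc
  · intro D g
    have hsum : ∑ E ∈ D.powerset, ∑ w ∈ Finset.univ.filter (fun w => Des w = E), γ g w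
        = ∑ w ∈ Finset.univ.filter (fun w => Des w ⊆ D), γ g w := by
      rw [← Finset.sum_fiberwise_of_maps_to (s := Finset.univ.filter (fun w => Des w ⊆ D))
        (t := D.powerset) (g := Des) (by simp)]
      refine Finset.sum_congr rfl fun E hE => Finset.sum_congr ?_ fun _ _ => rfl
      ext w
      simp only [Finset.mem_filter, Finset.mem_univ, true_and, Finset.mem_powerset] at hE ⊢
      constructor
      · rintro rfl; exact ⟨hE, rfl⟩
      · exact fun h => h.2
    rw [hsum]
    let Φ : (G → ℂ) →ₗ[ℂ] (G → ℂ) :=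
      ∑ p : P D, LinearMap.funLeft ℂ ℂ (fun v => g⁻¹ * v * p)
    have hΦ : ∀ F v, Φ F v = ∑ p : P D, F (g⁻¹ * v * p) := by
      intro F v
      simp [Φ, LinearMap.sum_apply, LinearMap.funLeft_apply]
    have ht1 : LinearMap.trace ℂ _ Φ = (Nat.card (P D) : ℂ) *
        ∑ w ∈ Finset.univ.filter (fun w => Des w ⊆ D), γ g w := by
      rw [LinearMap.trace_eq_matrix_trace ℂ b, Matrix.trace, Finset.sum_filter, Finset.mul_sum]
      refine Finset.sum_congr rfl fun w _ => ?_
      rw [Matrix.diag_apply, LinearMap.toMatrix_apply]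
      split_ifs with h
      · have : Φ (b w) = (Nat.card (P D) : ℂ) • T g (b w) := by
          funext v
          rw [hΦ, Pi.smul_apply, hTa]
          rw [Finset.sum_congr rfl (g := fun _ => b w (g⁻¹ * v))
            (fun p _ => by rw [hb, hMP D w h _ _ p.2])]
          simp
        rw [this]
        simp [γ]
      · rw [mul_zero]
        refine hsupp D _ ?_ w h
        intro v p hp
        rw [hΦ, hΦ]
        refine Fintype.sum_equiv (Equiv.mulLeft (⟨p, hp⟩ : P D)) _ _ fun q => ?_
        simp [mul_assoc]
    rw [← ht1, LinearMap.trace_eq_matrix_trace ℂ (Pi.basisFun ℂ G), Matrix.trace]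
    simp only [Matrix.diag_apply, LinearMap.toMatrix_apply, Pi.basisFun_repr, hΦ,
      Pi.basisFun_apply]
    rw [Nat.card_eq_fintype_card, Fintype.card_subtype, Finset.card_filter, Nat.cast_sum]
    refine Finset.sum_congr rfl fun v _ => ?_
    push_cast
    split_ifs with h
    · rw [Finset.sum_eq_single (⟨v⁻¹ * g * v, h⟩ : P D)]
      · simp [mul_assoc]
      · intro p _ hp
        rw [Pi.single_apply, if_neg]
        intro h'
        apply hp
        apply Subtype.ext
        have : (p : G) = v⁻¹ * g * (g⁻¹ * v * p) := by group
        rw [this, h']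
      · simp
    · refine Finset.sum_eq_zero fun p _ => ?_
      rw [Pi.single_apply, if_neg]
      intro h'
      apply h
      have : (p : G) = v⁻¹ * g * (g⁻¹ * v * p) := by group
      rw [h'] at this
      rw [← this]; exact p.2

set_option linter.unusedSimpArgs false

/-- tail sums -/
def lev {n : ℕ} (d : Fin n → ℕ) (j : Fin n) : ℕ := ∑ t ∈ Finset.Ici j, d t

theorem lev_anti {n : ℕ} (d : Fin n → ℕ) {j j' : Fin n} (h : j ≤ j') : lev d j' ≤ lev d j :=
  Finset.sum_le_sum_of_subset (Finset.Ici_subset_Ici.mpr h)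

theorem lev_eq_iff {n : ℕ} (d : Fin n → ℕ) {j j' : Fin n} (h : j ≤ j') :
    lev d j = lev d j' ↔ ∀ t, j ≤ t → t < j' → d t = 0 := by
  have h1 : lev d j = ∑ t ∈ Finset.Ico j j', d t + lev d j' := by
    have hI : Finset.Ici j = Finset.Ico j j' ∪ Finset.Ici j' := by
      ext t
      simp only [Finset.mem_Ici, Finset.mem_union, Finset.mem_Ico]
      constructor
      · intro ht
        by_cases hc : t < j'
        · exact Or.inl ⟨ht, hc⟩
        · exact Or.inr (not_lt.mp hc)
      · rintro (⟨h1, -⟩ | h1)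
        · exact h1
        · exact h.trans h1
    rw [lev, hI, Finset.sum_union, lev]
    rw [Finset.disjoint_left]
    intro t ht ht'
    simp only [Finset.mem_Ici, Finset.mem_Ico] at ht ht'
    exact absurd ht.2 (not_lt.mpr ht')
  rw [h1]
  constructor
  · intro h2 t ht ht'
    have h3 : ∑ t ∈ Finset.Ico j j', d t = 0 := by omega
    exact Finset.sum_eq_zero_iff.mp h3 t (by simp [ht, ht'])
  · intro h2
    rw [Finset.sum_eq_zero, zero_add]
    intro t ht
    simp only [Finset.mem_Ico] at ht
    exact h2 t ht.1 ht.2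

theorem lev_zero_iff {n : ℕ} (d : Fin n → ℕ) (j : Fin n) :
    lev d j = 0 ↔ ∀ t, j ≤ t → d t = 0 := by
  rw [lev, Finset.sum_eq_zero_iff]
  simp

/-- the base configuration -/
def bcfg (r : ℕ) {n : ℕ} (d : Fin n → ℕ) : Cfg r n := fun e => (lev d e, 0)

theorem mem_stab_bcfg {r n : ℕ} (d : Fin n → ℕ) (p : WreathProduct r n) :
    p ∈ MulAction.stabilizer (WreathProduct r n) (bcfg r d) ↔
      (∀ e, lev d (p.right e) = lev d e) ∧ ∀ e, lev d e ≠ 0 → p.col e = 0 := by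
  rw [MulAction.mem_stabilizer_iff]
  constructor
  · intro h
    have h1 : ∀ e, lev d (p.right⁻¹ e) = lev d e := fun e => congrArg Prod.fst (congrFun h e)
    refine ⟨fun e => by simpa using (h1 (p.right e)).symm, fun e he => ?_⟩
    have h2 := congrArg Prod.snd (congrFun h e)
    simp only [smul_cfg, cshift, bcfg, h1 e, he, if_false, zero_add] at h2
    exact h2
  · rintro ⟨h1, h2⟩
    funext e
    have h1' : lev d (p.right⁻¹ e) = lev d e := by simpa using (h1 (p.right⁻¹ e)).symm
    simp only [smul_cfg, cshift, bcfg, h1']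
    by_cases he : lev d e = 0
    · simp [he]
    · simp [he, h2 e he]

/-- indicator function -/
def ind {n : ℕ} (D : Finset (Fin n)) (t : Fin n) : ℕ := if t ∈ D then 1 else 0

theorem ind_zero {n : ℕ} (D : Finset (Fin n)) (t : Fin n) : ind D t = 0 ↔ t ∉ D := by
  simp [ind]

/-- stabilizers only get smaller as the support grows -/
theorem stab_mono {r n : ℕ} (d d' : Fin n → ℕ) (h : ∀ t, d' t = 0 → d t = 0) :
    MulAction.stabilizer (WreathProduct r n) (bcfg r d') ≤
      MulAction.stabilizer (WreathProduct r n) (bcfg r d) := by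
  intro p hp
  rw [mem_stab_bcfg] at hp ⊢
  refine ⟨fun e => ?_, fun e he => hp.2 e fun h0 => he ?_⟩
  · have h1 := hp.1 e
    rcases le_total (p.right e) e with hl | hl
    · rw [lev_eq_iff _ hl] at h1 ⊢
      exact fun t ht ht' => h t (h1 t ht ht')
    · rw [eq_comm, lev_eq_iff _ hl] at h1
      rw [eq_comm, lev_eq_iff _ hl]
      exact fun t ht ht' => h t (h1 t ht ht')
  · rw [lev_zero_iff] at h0 ⊢
    exact fun t ht => h t (h0 t ht)

/-- the word of a group element, encoded by integers -/
def wkey {r n : ℕ} (w : WreathProduct r n) (j : Fin n) : ℕ :=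
  (w.col (w.right j)).val * n + (w.right j : ℕ)

theorem key_div {n a b a' b' : ℕ} (hb : b < n) (hb' : b' < n) (h : a * n + b = a' * n + b') :
    a = a' ∧ b = b' := by
  have hn : 0 < n := by omega
  have h1 : (a * n + b) / n = a := by
    rw [mul_comm, Nat.mul_add_div hn, Nat.div_eq_of_lt hb, add_zero]
  have h2 : (a' * n + b') / n = a' := by
    rw [mul_comm, Nat.mul_add_div hn, Nat.div_eq_of_lt hb', add_zero]
  have : a = a' := by rw [← h1, h, h2]
  subst this
  exact ⟨rfl, by omega⟩

theorem wkey_inj {r n : ℕ} [NeZero r] : Function.Injective (wkey : WreathProduct r n → Fin n → ℕ) := by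
  intro w v h
  have h1 : ∀ j, (w.col (w.right j)).val = (v.col (v.right j)).val ∧ (w.right j : ℕ) = v.right j :=
    fun j => key_div (w.right j).2 (v.right j).2 (congrFun h j)
  have h2 : w.right = v.right := Equiv.ext fun j => Fin.ext (h1 j).2
  refine SemidirectProduct.ext ?_ h2
  funext e
  have h3 := (h1 (w.right⁻¹ e)).1
  rw [← h2] at h3
  have := ZMod.val_injective r h3
  simpa [WreathProduct.col] using this

theorem wkey_mul {r n : ℕ} (w p : WreathProduct r n) (j : Fin n) :
    wkey (w * p) j = (w.col (w.right (p.right j)) + p.col (p.right j)).val * n +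
      (w.right (p.right j) : ℕ) := by
  simp [wkey, WreathProduct.col_mul]

theorem wkey_mul_zero {r n : ℕ} (w p : WreathProduct r n) (j : Fin n) (h : p.col (p.right j) = 0) :
    wkey (w * p) j = wkey w (p.right j) := by
  rw [wkey_mul, h, add_zero, wkey]

theorem wkey_injOn {r n : ℕ} (w : WreathProduct r n) : Function.Injective (wkey w) := by
  intro j j' h
  exact w.right.injective (Fin.ext (key_div (w.right j).2 (w.right j').2 h).2)

open Classical in
/-- the descent set -/
noncomputable def wDes {r n : ℕ} (w : WreathProduct r n) : Finset (Fin n) :=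
  Finset.univ.filter fun t => (∃ h : (t : ℕ) + 1 < n, wkey w ⟨t + 1, h⟩ < wkey w t) ∨
    ((t : ℕ) + 1 = n ∧ w.col (w.right t) ≠ 0)

theorem wkey_mono {r n : ℕ} (w : WreathProduct r n) (D : Finset (Fin n)) (hD : wDes w ⊆ D) :
    ∀ m : ℕ, ∀ j j' : Fin n, (j' : ℕ) = j + m → lev (ind D) j = lev (ind D) j' →
      wkey w j ≤ wkey w j' := by
  intro m
  induction m with
  | zero =>
    intro j j' h _
    have : j = j' := Fin.ext (by omega)
    rw [this]
  | succ m ih =>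
    intro j j' h hl
    have hlt : (j : ℕ) + m < n := by have := j'.2; omega
    let i : Fin n := ⟨j + m, hlt⟩
    have hji : j ≤ i := Fin.mk_le_mk.mpr (by simp)
    have hij : i ≤ j' := Fin.mk_le_mk.mpr (by omega)
    have hl' := hl
    rw [lev_eq_iff _ (hji.trans hij)] at hl'
    have h1 := ih j i rfl ((lev_eq_iff _ hji).mpr fun t ht ht' => hl' t ht (ht'.trans_le hij))
    have h2 : i ∉ D := (ind_zero D i).mp (hl' i hji (Fin.mk_lt_mk.mpr (by omega)))
    have h3 : i ∉ wDes w := fun hh => h2 (hD hh)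
    simp only [wDes, Finset.mem_filter, Finset.mem_univ, true_and, not_or, not_exists, not_lt] at h3
    have h4 := h3.1 (by have := j'.2; simp only [i]; omega)
    have h5 : (⟨(i : ℕ) + 1, by have := j'.2; simp only [i]; omega⟩ : Fin n) = j' :=
      Fin.ext (by simp only [i]; omega)
    rw [h5] at h4
    exact h1.trans h4

theorem wkey_mono_le {r n : ℕ} (w : WreathProduct r n) (D : Finset (Fin n)) (hD : wDes w ⊆ D)
    {j j' : Fin n} (h : j ≤ j') (hl : lev (ind D) j = lev (ind D) j') :
      wkey w j ≤ wkey w j' :=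
  wkey_mono w D hD (j' - j) j j' (by have : (j : ℕ) ≤ j' := h; omega) hl

theorem col_zero_of_lev {r n : ℕ} [NeZero r] (w : WreathProduct r n) (D : Finset (Fin n))
    (hD : wDes w ⊆ D) (j : Fin n) (hl : lev (ind D) j = 0) : w.col (w.right j) = 0 := by
  have hn : 0 < n := j.pos
  let m : Fin n := ⟨n - 1, by omega⟩
  have hjm : j ≤ m := Fin.mk_le_mk.mpr (by have := j.2; omega)
  have hlm : lev (ind D) m = 0 := Nat.le_zero.mp (hl ▸ lev_anti _ hjm)
  have h1 := wkey_mono_le w D hD hjm (hl.trans hlm.symm)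
  have h2 : m ∉ D := (ind_zero D m).mp ((lev_zero_iff _ _).mp hlm m le_rfl)
  have h3 : m ∉ wDes w := fun hh => h2 (hD hh)
  simp only [wDes, Finset.mem_filter, Finset.mem_univ, true_and, not_or, not_and, not_not] at h3
  have h4 := h3.2 (by simp only [m]; omega)
  have h5 : wkey w m < n := by
    rw [wkey, h4]; simp
  have h6 : wkey w j < n := by omega
  rw [wkey] at h6
  rw [← ZMod.val_eq_zero]
  by_contra hne
  have : 1 * n ≤ (w.col (w.right j)).val * n := Nat.mul_le_mul_right _ (by omega)
  omega

/-- elements without descents outside `D` are minimal in their coset -/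
theorem wkey_min {r n : ℕ} [NeZero r] (D : Finset (Fin n)) (w p : WreathProduct r n)
    (hD : wDes w ⊆ D)
    (hp : p ∈ MulAction.stabilizer (WreathProduct r n) (bcfg r (ind D))) :
    toLex (wkey w) ≤ toLex (wkey (w * p)) := by
  rw [mem_stab_bcfg] at hp
  obtain ⟨hp1, hp2⟩ := hp
  have hge : ∀ j, wkey w (p.right j) ≤ wkey (w * p) j := by
    intro j
    by_cases h : lev (ind D) (p.right j) = 0
    · rw [wkey, col_zero_of_lev w D hD _ h, wkey_mul]
      simp
    · rw [wkey_mul_zero _ _ _ (hp2 _ h)]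
  by_contra hlt
  rw [not_le] at hlt
  obtain ⟨j, hj1, hj2⟩ := hlt
  simp only [Pi.toLex_apply] at hj1 hj2
  have hfix' : ∀ i < j, p.right i ≤ i := by
    intro i hi
    by_contra hc
    rw [not_le] at hc
    have h1 := wkey_mono_le w D hD hc.le (hp1 i).symm
    have h2 := hge i
    rw [hj1 i hi] at h2
    exact hc.ne (wkey_injOn w (le_antisymm h1 h2))
  have hfix : ∀ m : ℕ, ∀ i : Fin n, (i : ℕ) = m → i < j → p.right i = i := by
    intro m
    induction m using Nat.strong_induction_on with
    | _ m ih =>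
      intro i him hij
      by_contra hne
      have hlt : p.right i < i := lt_of_le_of_ne (hfix' i hij) hne
      have := ih (p.right i) (by rw [← him]; exact hlt) (p.right i) rfl (hlt.trans hij)
      exact hne (p.right.injective this)
  have hjj : j ≤ p.right j := by
    by_contra hc
    rw [not_le] at hc
    have := hfix _ (p.right j) rfl hc
    exact hc.ne (p.right.injective this)
  have h1 := wkey_mono_le w D hD hjj (hp1 j).symm
  exact absurd (h1.trans (hge j)) (not_le.mpr hj2)

/-- every coset contains an element without descents outside `D` -/
theorem exists_des {r n : ℕ} [NeZero r] (D : Finset (Fin n)) (v : WreathProduct r n) :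
    ∃ p ∈ MulAction.stabilizer (WreathProduct r n) (bcfg r (ind D)), wDes (v * p) ⊆ D := by
  classical
  have : Finite (WreathProduct r n) := Finite.of_equiv _ SemidirectProduct.equivProd.symm
  obtain ⟨⟨p, hp⟩, hmin⟩ := Finite.exists_min
    (fun p : MulAction.stabilizer (WreathProduct r n) (bcfg r (ind D)) =>
      toLex (wkey (v * (p : WreathProduct r n))))
  refine ⟨p, hp, ?_⟩
  intro t ht
  by_contra htD
  set w := v * p with hw
  suffices h : ∃ q ∈ MulAction.stabilizer (WreathProduct r n) (bcfg r (ind D)),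
      toLex (wkey (w * q)) < toLex (wkey w) by
    obtain ⟨q, hq, hlt⟩ := h
    have := hmin ⟨p * q, mul_mem hp hq⟩
    simp only [← mul_assoc, ← hw] at this
    exact absurd hlt (not_lt.mpr this)
  simp only [wDes, Finset.mem_filter, Finset.mem_univ, true_and] at ht
  rcases ht with ⟨hn, hlt⟩ | ⟨hn, hne⟩
  · let t' : Fin n := ⟨t + 1, hn⟩
    let q : WreathProduct r n := ⟨1, Equiv.swap t t'⟩
    have hqc : ∀ e, q.col e = 0 := fun e => rfl
    have htt : t < t' := Fin.mk_lt_mk.mpr (by simp)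
    refine ⟨q, (mem_stab_bcfg _ _).mpr ⟨fun e => ?_, fun e _ => hqc e⟩, t, ?_, ?_⟩
    · have hl : lev (ind D) t = lev (ind D) t' := by
        rw [lev_eq_iff _ htt.le]
        intro u hu hu'
        have : u = t := Fin.ext (by
          have h1 : (t : ℕ) ≤ u := hu
          have h2 : (u : ℕ) < t + 1 := hu'
          omega)
        rw [this]; exact (ind_zero _ _).mpr htD
      show lev (ind D) (Equiv.swap t t' e) = _
      by_cases h1 : e = t
      · rw [h1, Equiv.swap_apply_left, hl]
      · by_cases h2 : e = t'
        · rw [h2, Equiv.swap_apply_right, hl]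
        · rw [Equiv.swap_apply_of_ne_of_ne h1 h2]
    · intro i hi
      simp only [Pi.toLex_apply]
      rw [wkey_mul_zero _ _ _ (hqc _)]
      show wkey w (Equiv.swap t t' i) = _
      rw [Equiv.swap_apply_of_ne_of_ne hi.ne (hi.trans htt).ne]
    · simp only [Pi.toLex_apply]
      rw [wkey_mul_zero _ _ _ (hqc _)]
      show wkey w (Equiv.swap t t' t) < _
      rw [Equiv.swap_apply_left]
      exact hlt
  · let q : WreathProduct r n :=
      ⟨fun e => Multiplicative.ofAdd (if e = t then - w.col (w.right t) else 0), 1⟩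
    have hqc : ∀ e, q.col e = if e = t then - w.col (w.right t) else 0 := fun e => rfl
    have hqr : ∀ e, q.right e = e := fun e => rfl
    refine ⟨q, (mem_stab_bcfg _ _).mpr ⟨fun e => rfl, fun e he => ?_⟩, t, ?_, ?_⟩
    · rw [hqc, if_neg]
      rintro rfl
      apply he
      rw [lev_zero_iff]
      intro u hu
      have : u = e := Fin.ext (by
          have h1 : (e : ℕ) ≤ u := hu
          have h2 := u.2
          omega)
      rw [this]; exact (ind_zero _ _).mpr htD
    · intro i hi
      simp only [Pi.toLex_apply]
      rw [wkey_mul_zero _ _ _ (by rw [hqc, hqr, if_neg hi.ne])]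
      rfl
    · simp only [Pi.toLex_apply]
      rw [wkey_mul, hqc, hqr, if_pos rfl, add_neg_cancel, wkey]
      simp only [ZMod.val_zero, zero_mul, zero_add]
      have h1 : 0 < (w.col (w.right t)).val := Nat.pos_of_ne_zero fun h => hne ((ZMod.val_eq_zero _).mp h)
      have h2 : 0 < n := t.pos
      have := Nat.mul_pos h1 h2
      omega

instance wfintype {r n : ℕ} [NeZero r] : Fintype (WreathProduct r n) :=
  Fintype.ofEquiv _ SemidirectProduct.equivProd.symm

/-- the descent characters of the wreath product -/
theorem wreath_descent_chars (r n : ℕ) [NeZero r] :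
    ∃ β : Finset (Fin n) → WreathProduct r n → ℂ, (∀ D, IsCharacter (WreathProduct r n) (β D)) ∧
      ∀ D g, (Nat.card (MulAction.stabilizer (WreathProduct r n) (bcfg r (ind D))) : ℂ) *
        ∑ E ∈ D.powerset, β E g =
        (Nat.card {v : WreathProduct r n // v⁻¹ * g * v ∈
          MulAction.stabilizer (WreathProduct r n) (bcfg r (ind D))} : ℂ) := by
  refine descent_chars wDes
    (fun D => MulAction.stabilizer (WreathProduct r n) (bcfg r (ind D))) ?_
    (fun w => toLex (wkey w)) (fun w v h => wkey_inj (toLex.injective h)) ?_ ?_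
  · intro D D' h
    refine stab_mono _ _ fun t ht => ?_
    rw [ind_zero] at ht ⊢
    exact fun h' => ht (h h')
  · exact fun D w p h1 h2 => wkey_min D w p h1 h2
  · exact fun D v => exists_des D v

set_option linter.unusedSimpArgs false

/-- bounded compositions with prescribed non-zero entries -/
def Ds (n i : ℕ) (E : Finset (Fin n)) : Finset (Fin n → ℕ) :=
  (Fintype.piFinset fun _ => Finset.range (i + 1)).filter
    fun d => ∑ t, d t ≤ i ∧ ∀ t ∈ E, d t ≠ 0

theorem mem_Ds {n i : ℕ} {E : Finset (Fin n)} {d : Fin n → ℕ} :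
    d ∈ Ds n i E ↔ ∑ t, d t ≤ i ∧ ∀ t ∈ E, d t ≠ 0 := by
  simp only [Ds, Finset.mem_filter, Fintype.mem_piFinset, Finset.mem_range, and_iff_right_iff_imp]
  rintro ⟨h, -⟩ t
  have := Finset.single_le_sum (f := d) (fun _ _ => Nat.zero_le _) (Finset.mem_univ t)
  omega

theorem sum_ind {n : ℕ} (E : Finset (Fin n)) : ∑ t, ind E t = E.card := by
  simp [ind]

theorem card_Ds (n i : ℕ) (E : Finset (Fin n)) :
    (Ds n i E).card = if E.card ≤ i then (n + (i - E.card)).choose n else 0 := by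
  have hle : ∀ d ∈ Ds n i E, ∀ t, ind E t ≤ d t := by
    intro d hd t
    rw [mem_Ds] at hd
    by_cases h : t ∈ E
    · have := hd.2 t h
      simp only [ind, h, if_true]; omega
    · simp [ind, h]
  split_ifs with h
  · have h1 : (n + (i - E.card)).choose n =
        (Finset.finsuppAntidiag (Finset.univ : Finset (Fin (n + 1))) (i - E.card)).card := by
      rw [Finset.card_finsuppAntidiag_nat_eq_choose]
      simp only [Finset.card_univ, Fintype.card_fin]
      have : n + 1 + (i - E.card) - 1 = n + (i - E.card) := by omega
      rw [this, Nat.choose_symm_add]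
    rw [h1]
    refine Finset.card_bij'
      (fun d _ => Finsupp.equivFunOnFinite.symm
        (Fin.cons (i - ∑ t, d t) (fun t => d t - ind E t) : Fin (n + 1) → ℕ))
      (fun c _ => fun t => c t.succ + ind E t) ?_ ?_ ?_ ?_
    · intro d hd
      have h2 : ∑ t, (d t - ind E t) = ∑ t, d t - E.card := by
        rw [Finset.sum_tsub_distrib _ (fun t _ => hle d hd t), sum_ind]
      have h3 : E.card ≤ ∑ t, d t := by
        rw [← sum_ind]; exact Finset.sum_le_sum fun t _ => hle d hd t
      rw [mem_Ds] at hd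
      simp only [Finset.mem_finsuppAntidiag, Finset.subset_univ, and_true]
      simp only [Finsupp.equivFunOnFinite_symm_apply_apply, Fin.sum_univ_succ, Fin.cons_zero,
        Fin.cons_succ, h2]
      omega
    · intro c hc
      simp only [Finset.mem_finsuppAntidiag, Finset.subset_univ, and_true, Fin.sum_univ_succ] at hc
      rw [mem_Ds]
      refine ⟨?_, fun t ht => ?_⟩
      · rw [Finset.sum_add_distrib, sum_ind]; omega
      · simp [ind, ht]
    · intro d hd
      funext t
      have := hle d hd t
      simp only [Finsupp.equivFunOnFinite_symm_apply_apply, Fin.cons_succ]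
      omega
    · intro c hc
      simp only [Finset.mem_finsuppAntidiag, Finset.subset_univ, and_true, Fin.sum_univ_succ] at hc
      ext t
      simp only [Finsupp.equivFunOnFinite_symm_apply_apply]
      refine Fin.cases ?_ (fun t => ?_) t
      · rw [Fin.cons_zero, Finset.sum_add_distrib, sum_ind]; omega
      · rw [Fin.cons_succ]; omega
  · rw [Finset.card_eq_zero, Finset.eq_empty_iff_forall_notMem]
    intro d hd
    have h3 : E.card ≤ ∑ t, d t := by
      rw [← sum_ind]; exact Finset.sum_le_sum fun t _ => hle d hd t
    rw [mem_Ds] at hd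
    omega

/-- fixed points on an orbit -/
theorem fix_orbit {G X : Type*} [Group G] [Fintype G] [MulAction G X] [DecidableEq X] (x : X)
    (g : G) : Nat.card (MulAction.stabilizer G x) *
      ((Finset.univ.image (fun v : G => v • x)).filter (fun f => g • f = f)).card =
      Nat.card {v : G // v⁻¹ * g * v ∈ MulAction.stabilizer G x} := by
  classical
  rw [Nat.card_eq_fintype_card (α := {v : G // v⁻¹ * g * v ∈ MulAction.stabilizer G x}),
    Fintype.card_subtype]
  have hiff : ∀ v : G, v⁻¹ * g * v ∈ MulAction.stabilizer G x ↔ g • (v • x) = v • x := by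
    intro v
    rw [MulAction.mem_stabilizer_iff, mul_smul, mul_smul, inv_smul_eq_iff]
  rw [Finset.card_eq_sum_card_fiberwise (f := fun v : G => v • x)
    (t := (Finset.univ.image (fun v : G => v • x)).filter (fun f => g • f = f))]
  · rw [Finset.sum_const_nat (m := Nat.card (MulAction.stabilizer G x)), mul_comm]
    intro f hf
    simp only [Finset.mem_filter, Finset.mem_image, Finset.mem_univ, true_and] at hf
    obtain ⟨⟨u, rfl⟩, hu⟩ := hf
    rw [Nat.card_eq_fintype_card, ← Finset.card_univ]
    symm
    refine Finset.card_bij (fun p _ => u * (p : G)) ?_ ?_ ?_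
    · intro p _
      have hp : (p : G) • x = x := p.2
      simp only [Finset.mem_filter, Finset.mem_univ, true_and, hiff, mul_smul, hp]
      exact ⟨hu, trivial⟩
    · intro p _ q _ h
      exact Subtype.ext (mul_left_cancel h)
    · intro v hv
      simp only [Finset.mem_filter, Finset.mem_univ, true_and, hiff] at hv
      refine ⟨⟨u⁻¹ * v, ?_⟩, Finset.mem_univ _, by simp⟩
      rw [MulAction.mem_stabilizer_iff, mul_smul, hv.2, inv_smul_smul]
  · intro v hv
    simp only [Finset.coe_filter, Set.mem_ofPred_eq, Finset.mem_univ, true_and, hiff] at hv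
    simp only [Finset.coe_filter, Set.mem_ofPred_eq, Finset.mem_image, Finset.mem_univ, true_and]
    exact ⟨⟨v, rfl⟩, hv⟩

theorem lev_succ {n : ℕ} (d : Fin n → ℕ) (t : Fin n) :
    lev d t = d t + if h : (t : ℕ) + 1 < n then lev d ⟨t + 1, h⟩ else 0 := by
  rw [lev, ← Finset.Ioi_insert, Finset.sum_insert (by simp)]
  congr 1
  split_ifs with h
  · rw [lev]
    refine Finset.sum_congr ?_ fun _ _ => rfl
    ext u
    simp only [Finset.mem_Ioi, Finset.mem_Ici, Fin.lt_def, Fin.le_def]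
    omega
  · refine Finset.sum_eq_zero fun u hu => ?_
    simp only [Finset.mem_Ioi, Fin.lt_def] at hu
    have := u.2
    omega

theorem lev_le_sum {n : ℕ} (d : Fin n → ℕ) (t : Fin n) : lev d t ≤ ∑ t, d t :=
  Finset.sum_le_sum_of_subset (Finset.subset_univ _)

theorem lev_inj {n : ℕ} : Function.Injective (lev : (Fin n → ℕ) → Fin n → ℕ) := by
  intro d d' h
  funext t
  have h1 := lev_succ d t
  have h2 := lev_succ d' t
  rw [h] at h1
  omega

/-- every configuration is in the orbit of a base configuration -/
theorem exists_base {r n i : ℕ} [NeZero r] (f : Cfg r n) (hf : f ∈ Om r n i) :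
    ∃ d ∈ Ds n i ∅, ∃ v : WreathProduct r n, v • bcfg r d = f := by
  rw [mem_Om] at hf
  simp only [mem_Xs] at hf
  let σ : Equiv.Perm (Fin n) := Tuple.sort (fun e => OrderDual.toDual (f e).1)
  have hσ : ∀ a b, a ≤ b → (f (σ b)).1 ≤ (f (σ a)).1 := by
    intro a b hab
    exact OrderDual.toDual_le_toDual.mp
      (Tuple.monotone_sort (fun e => OrderDual.toDual (f e).1) hab)
  let d : Fin n → ℕ := fun t => (f (σ t)).1 - if h : (t : ℕ) + 1 < n then (f (σ ⟨t + 1, h⟩)).1 else 0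
  have hlev : ∀ m : ℕ, ∀ t : Fin n, (t : ℕ) + m + 1 = n → lev d t = (f (σ t)).1 := by
    intro m
    induction m with
    | zero =>
      intro t ht
      rw [lev_succ]
      have : ¬ ((t : ℕ) + 1 < n) := by omega
      simp [d, this]
    | succ m ih =>
      intro t ht
      have h1 : (t : ℕ) + 1 < n := by omega
      rw [lev_succ, dif_pos h1, ih ⟨t + 1, h1⟩ (by simp only; omega)]
      simp only [d, h1, dif_pos]
      have := hσ t ⟨t + 1, h1⟩ (Fin.mk_le_mk.mpr (by omega))
      omega
  have hlev' : ∀ t : Fin n, lev d t = (f (σ t)).1 := fun t => hlev (n - 1 - t) t (by have := t.2; omega)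
  refine ⟨d, mem_Ds.mpr ⟨?_, by simp⟩, ⟨fun e => Multiplicative.ofAdd (f e).2, σ⟩, ?_⟩
  · rcases Nat.eq_zero_or_pos n with hn | hn
    · subst hn; simp
    · have : ∑ t, d t = lev d ⟨0, hn⟩ := by
        rw [lev]
        refine Finset.sum_congr ?_ fun _ _ => rfl
        ext u; simp [Fin.le_def]
      rw [this, hlev']
      exact (hf _).1
  · funext e
    rw [smul_cfg]
    show cshift ((f e).2) (lev d (σ⁻¹ e), 0) = f e
    rw [hlev']
    have hs : σ (σ⁻¹ e) = e := by simp
    rw [hs]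
    refine Prod.ext rfl ?_
    simp only [cshift, zero_add]
    split_ifs with h
    · exact ((hf e).2 h).symm
    · rfl

theorem base_unique {r n : ℕ} (d d' : Fin n → ℕ) (v v' : WreathProduct r n)
    (h : v • bcfg r d = v' • bcfg r d') : d = d' := by
  apply lev_inj
  have h1 : ∀ e, lev d (v.right⁻¹ e) = lev d' (v'.right⁻¹ e) :=
    fun e => congrArg Prod.fst (congrFun h e)
  have h2 := Tuple.unique_antitone (f := fun e => lev d (v.right⁻¹ e)) (σ := v.right)
    (τ := v'.right) (fun a b hab => by simpa using lev_anti d hab)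
    (fun a b hab => by
      simp only [Function.comp_apply, h1]
      simpa using lev_anti d' hab)
  funext t
  have := congrFun h2 t
  simp only [Function.comp_apply] at this
  rw [h1 (v'.right t)] at this
  simpa using this

theorem base_mem_Om {r n i : ℕ} [NeZero r] (d : Fin n → ℕ) (hd : d ∈ Ds n i ∅)
    (v : WreathProduct r n) : v • bcfg r d ∈ Om r n i := by
  apply smul_mem_Om
  rw [mem_Om]
  intro e
  rw [mem_Xs]
  exact ⟨(lev_le_sum d e).trans (mem_Ds.mp hd).1, fun _ => rfl⟩

theorem chi_expand {r n : ℕ} [NeZero r] (β : Finset (Fin n) → WreathProduct r n → ℂ)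
    (hβ : ∀ D g, (Nat.card (MulAction.stabilizer (WreathProduct r n) (bcfg r (ind D))) : ℂ) *
        ∑ E ∈ D.powerset, β E g =
        (Nat.card {v : WreathProduct r n // v⁻¹ * g * v ∈
          MulAction.stabilizer (WreathProduct r n) (bcfg r (ind D))} : ℂ))
    (i : ℕ) (g : WreathProduct r n) :
    ((r : ℂ) * i + 1) ^ g.len = ∑ E : Finset (Fin n), ((Ds n i E).card : ℂ) * β E g := by
  classical
  have h0 : ((r : ℂ) * i + 1) ^ g.len = (((r * i + 1) ^ g.len : ℕ) : ℂ) := by push_cast; rfl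
  rw [h0, ← card_fixed]
  have h1 : (Om r n i).filter (fun f => g • f = f) = (Ds n i ∅).biUnion fun d =>
      (Finset.univ.image (fun v : WreathProduct r n => v • bcfg r d)).filter
        (fun f => g • f = f) := by
    ext f
    simp only [Finset.mem_filter, Finset.mem_biUnion, Finset.mem_image, Finset.mem_univ, true_and]
    constructor
    · rintro ⟨hf, hg⟩
      obtain ⟨d, hd, v, hv⟩ := exists_base f hf
      exact ⟨d, hd, ⟨v, hv⟩, hg⟩
    · rintro ⟨d, hd, ⟨v, rfl⟩, hg⟩
      exact ⟨base_mem_Om d hd v, hg⟩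
  rw [h1, Finset.card_biUnion]
  · rw [Nat.cast_sum]
    have h2 : ∀ d : Fin n → ℕ, ((((Finset.univ.image (fun v : WreathProduct r n => v • bcfg r d)).filter
        (fun f => g • f = f)).card : ℕ) : ℂ) =
        ∑ E : Finset (Fin n), if (∀ t ∈ E, d t ≠ 0) then β E g else 0 := by
      intro d
      set D : Finset (Fin n) := Finset.univ.filter (fun t => d t ≠ 0) with hD
      have hst : MulAction.stabilizer (WreathProduct r n) (bcfg r d) =
          MulAction.stabilizer (WreathProduct r n) (bcfg r (ind D)) := by
        apply le_antisymm
        · apply stab_mono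
          intro t ht; rw [ind_zero]; simp [hD, ht]
        · apply stab_mono
          intro t ht; rw [ind_zero] at ht; simpa [hD] using ht
      have h3 := hβ D g
      rw [← hst, ← fix_orbit] at h3
      push_cast at h3
      have hne : (Nat.card (MulAction.stabilizer (WreathProduct r n) (bcfg r d)) : ℂ) ≠ 0 := by
        exact_mod_cast Nat.card_pos.ne'
      have h4 := mul_left_cancel₀ hne h3
      rw [← h4, ← Finset.sum_filter]
      refine Finset.sum_congr ?_ fun _ _ => rfl
      ext E
      simp [hD, Finset.subset_iff]
    rw [Finset.sum_congr rfl fun d _ => h2 d, Finset.sum_comm]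
    refine Finset.sum_congr rfl fun E _ => ?_
    rw [← Finset.sum_filter, Finset.sum_const, nsmul_eq_mul]
    congr 3
    ext d
    simp [mem_Ds]
  · intro d _ d' _ hdd
    rw [Function.onFun, Finset.disjoint_left]
    intro f hf hf'
    simp only [Finset.mem_filter, Finset.mem_image, Finset.mem_univ, true_and] at hf hf'
    obtain ⟨⟨v, rfl⟩, -⟩ := hf
    obtain ⟨⟨v', h⟩, -⟩ := hf'
    exact hdd (base_unique _ _ _ _ h.symm)

/-- the binomial inversion -/
theorem binom_inv (n k δ : ℕ) : ∑ j ∈ Finset.range (k + 1), (-1 : ℂ) ^ j * ((n + 1).choose j : ℂ) *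
    ((if δ ≤ k - j then (n + (k - j - δ)).choose n else 0 : ℕ) : ℂ) = if k = δ then 1 else 0 := by
  open PowerSeries in
  have h1 : (PowerSeries.mk fun m => ((n + m).choose n : ℂ)) * (1 - X : ℂ⟦X⟧) ^ (n + 1) = 1 := by
    rw [← mk_one_pow_eq_mk_choose_add, ← mul_pow, mk_one_mul_one_sub_eq_one, one_pow]
  have h2 : ((1 - PowerSeries.X : PowerSeries ℂ) ^ (n + 1)) =
      PowerSeries.mk fun j => (-1 : ℂ) ^ j * ((n + 1).choose j : ℂ) := by
    generalize n + 1 = N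
    induction N with
    | zero =>
      ext j
      rw [PowerSeries.coeff_mk, pow_zero, PowerSeries.coeff_one]
      rcases j with _ | j <;> simp
    | succ N ih =>
      rw [pow_succ, ih]
      ext j
      rw [mul_sub, mul_one, map_sub, PowerSeries.coeff_mk, PowerSeries.coeff_mk]
      rcases j with _ | j
      · simp
      · rw [PowerSeries.coeff_succ_mul_X, PowerSeries.coeff_mk, Nat.choose_succ_succ]
        push_cast
        ring
  have h3 : (PowerSeries.mk fun j => (-1 : ℂ) ^ j * ((n + 1).choose j : ℂ)) *
      (PowerSeries.X ^ δ * PowerSeries.mk fun m => ((n + m).choose n : ℂ)) = PowerSeries.X ^ δ := by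
    rw [← h2, mul_left_comm, mul_comm ((1 - PowerSeries.X) ^ (n + 1)), h1, mul_one]
  have h4 := congrArg (PowerSeries.coeff k) h3
  rw [PowerSeries.coeff_mul, Finset.Nat.sum_antidiagonal_eq_sum_range_succ_mk,
    PowerSeries.coeff_X_pow] at h4
  rw [← h4]
  refine Finset.sum_congr rfl fun j _ => ?_
  rw [PowerSeries.coeff_mk, PowerSeries.coeff_X_pow_mul']
  congr 1
  split_ifs <;> simp

theorem foulkes_eq {r n : ℕ} [NeZero r] (β : Finset (Fin n) → WreathProduct r n → ℂ)
    (hβ : ∀ D g, (Nat.card (MulAction.stabilizer (WreathProduct r n) (bcfg r (ind D))) : ℂ) *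
        ∑ E ∈ D.powerset, β E g =
        (Nat.card {v : WreathProduct r n // v⁻¹ * g * v ∈
          MulAction.stabilizer (WreathProduct r n) (bcfg r (ind D))} : ℂ))
    (k : ℕ) (g : WreathProduct r n) :
    foulkesChar r n k g = ∑ E ∈ Finset.univ.filter (fun E : Finset (Fin n) => E.card = k), β E g := by
  rw [foulkesChar, Finset.sum_congr rfl fun j _ => by rw [chi_expand β hβ (k - j) g, Finset.mul_sum],
    Finset.sum_comm, Finset.sum_filter]
  refine Finset.sum_congr rfl fun E _ => ?_
  have h := binom_inv n k E.card
  rw [Finset.sum_congr rfl fun j _ => by rw [← mul_assoc, card_Ds], ← Finset.sum_mul, h]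
  simp [eq_comm]

set_option linter.unusedSimpArgs false

/-- the subgroup preserving a set of positions -/
def HA (r : ℕ) {n : ℕ} (A : Finset (Fin n)) : Subgroup (WreathProduct r n) where
  carrier := {w | ∀ e, w.right e ∈ A ↔ e ∈ A}
  mul_mem' := by
    intro a b ha hb e
    rw [SemidirectProduct.mul_right, Equiv.Perm.mul_apply, ha, hb]
  one_mem' := by intro e; rfl
  inv_mem' := by
    intro a ha e
    rw [SemidirectProduct.inv_right, ← ha (a.right⁻¹ e)]
    simp

theorem mem_HA {r n : ℕ} (A : Finset (Fin n)) (w : WreathProduct r n) :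
    w ∈ HA r A ↔ ∀ e, w.right e ∈ A ↔ e ∈ A := Iff.rfl

theorem HA_inv {r n : ℕ} {A : Finset (Fin n)} {w : WreathProduct r n} (h : w ∈ HA r A) (e : Fin n) :
    w.right⁻¹ e ∈ A ↔ e ∈ A := by
  rw [← (mem_HA A w).mp h]; simp

/-- the restricted permutation -/
def HA.res {r n : ℕ} {A : Finset (Fin n)} (w : HA r A) : Equiv.Perm {e // e ∈ A} :=
  (w : WreathProduct r n).right.subtypePerm w.2

theorem sum_col_HA {r n : ℕ} {A : Finset (Fin n)} (g : HA r A) (x : Fin n → ZMod r) :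
    ∑ e ∈ A, x ((g : WreathProduct r n).right⁻¹ e) = ∑ e ∈ A, x e := by
  refine Finset.sum_nbij' (fun e => (g : WreathProduct r n).right⁻¹ e)
    (fun e => (g : WreathProduct r n).right e) ?_ ?_ ?_ ?_ ?_
  · intro e he; exact (HA_inv g.2 e).mpr he
  · intro e he; exact (g.2 e).mpr he
  · intro e _; simp
  · intro e _; simp
  · intro e _; rfl

/-- the linear character: sign times color character on `A` -/
noncomputable def psi (r : ℕ) [NeZero r] {n : ℕ} (A : Finset (Fin n)) : HA r A →* ℂ where
  toFun w := ((Equiv.Perm.sign (HA.res w) : ℤ) : ℂ) *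
    ZMod.stdAddChar (∑ e ∈ A, (w : WreathProduct r n).col e)
  map_one' := by
    have h1 : HA.res (1 : HA r A) = 1 := by ext e; rfl
    rw [h1]
    simp [WreathProduct.col_one]
  map_mul' g h := by
    have h1 : HA.res (g * h) = HA.res g * HA.res h := by ext e; rfl
    have h2 : ∑ e ∈ A, ((g * h : HA r A) : WreathProduct r n).col e =
        ∑ e ∈ A, (g : WreathProduct r n).col e + ∑ e ∈ A, (h : WreathProduct r n).col e := by
      rw [← sum_col_HA g (fun e => (h : WreathProduct r n).col e), ← Finset.sum_add_distrib]
      refine Finset.sum_congr rfl fun e _ => ?_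
      rw [Subgroup.coe_mul, WreathProduct.col_mul]
    rw [h1, h2, map_mul, AddChar.map_add_eq_mul]
    push_cast
    ring

theorem psi_apply {r : ℕ} [NeZero r] {n : ℕ} (A : Finset (Fin n)) (w : HA r A) :
    psi r A w = ((Equiv.Perm.sign (HA.res w) : ℤ) : ℂ) *
      ZMod.stdAddChar (∑ e ∈ A, (w : WreathProduct r n).col e) := rfl

/-- good configurations -/
def good {r n : ℕ} (A : Finset (Fin n)) (f : Cfg r n) : Prop :=
  (∀ e ∈ A, (f e).1 ≠ 0) ∧ ∀ e ∈ A, ∀ e' ∈ A, (f e).1 = (f e').1 → e = e'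

theorem good_psi {r n : ℕ} [NeZero r] {A : Finset (Fin n)} {f : Cfg r n} (hf : good A f)
    (h : HA r A) (hh : (h : WreathProduct r n) • f = f) : psi r A h = 1 := by
  have h1 : ∀ e ∈ A, (h : WreathProduct r n).right⁻¹ e = e := by
    intro e he
    refine hf.2 _ ((HA_inv h.2 e).mpr he) e he ?_
    have := congrArg Prod.fst (congrFun hh e)
    exact this
  have h2 : ∀ e ∈ A, (h : WreathProduct r n).col e = 0 := by
    intro e he
    have := congrArg Prod.snd (congrFun hh e)
    rw [smul_cfg, h1 e he] at this
    simp only [cshift, hf.1 e he, if_false] at this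
    simpa using this
  have h3 : HA.res h = 1 := by
    ext e
    have := h1 e e.2
    rw [Equiv.Perm.inv_eq_iff_eq] at this
    exact congrArg Fin.val this.symm
  rw [psi_apply, h3, Finset.sum_eq_zero h2]
  simp

theorem good_smul {r n : ℕ} {A : Finset (Fin n)} {f : Cfg r n} (hf : good A f)
    (h : HA r A) : good A ((h : WreathProduct r n) • f) := by
  refine ⟨fun e he => hf.1 _ ((HA_inv h.2 e).mpr he), fun e he e' he' hee => ?_⟩
  have := hf.2 _ ((HA_inv h.2 e).mpr he) _ ((HA_inv h.2 e').mpr he') hee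
  exact (h : WreathProduct r n).right⁻¹.injective this

theorem not_good {r n : ℕ} [NeZero r] (hr : 2 ≤ r) {A : Finset (Fin n)} {f : Cfg r n}
    (hf : ¬ good A f) : ∃ h : HA r A, (h : WreathProduct r n) • f = f ∧ psi r A h ≠ 1 := by
  by_cases h1 : ∀ e ∈ A, (f e).1 ≠ 0
  · have h2 : ∃ e ∈ A, ∃ e' ∈ A, (f e).1 = (f e').1 ∧ e ≠ e' := by
      by_contra hc
      push Not at hc
      exact hf ⟨h1, hc⟩
    obtain ⟨e, he, e', he', hl, hne⟩ := h2
    let q : WreathProduct r n := ⟨fun u => Multiplicative.ofAdd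
      (if u = e then (f e).2 - (f e').2 else if u = e' then (f e').2 - (f e).2 else 0),
      Equiv.swap e e'⟩
    have hqc : ∀ u, q.col u = if u = e then (f e).2 - (f e').2 else
      if u = e' then (f e').2 - (f e).2 else 0 := fun u => rfl
    have hqr : q.right = Equiv.swap e e' := rfl
    have hq : q ∈ HA r A := by
      intro u
      rw [hqr]
      by_cases hu : u = e
      · rw [hu, Equiv.swap_apply_left]; simp [he, he']
      · by_cases hu' : u = e'
        · rw [hu', Equiv.swap_apply_right]; simp [he, he']
        · rw [Equiv.swap_apply_of_ne_of_ne hu hu']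
    refine ⟨⟨q, hq⟩, ?_, ?_⟩
    · funext u
      show (q • f) u = f u
      rw [smul_cfg, hqr, Equiv.swap_inv, hqc]
      by_cases hu : u = e
      · subst hu
        rw [Equiv.swap_apply_left, if_pos rfl]
        refine Prod.ext hl.symm ?_
        simp [cshift, h1 e' he']
      · by_cases hu' : u = e'
        · subst hu'
          rw [Equiv.swap_apply_right, if_neg hu, if_pos rfl]
          refine Prod.ext hl ?_
          simp [cshift, h1 e he]
        · rw [Equiv.swap_apply_of_ne_of_ne hu hu', if_neg hu, if_neg hu', cshift_zero]
    · have hs : HA.res (⟨q, hq⟩ : HA r A) = Equiv.swap ⟨e, he⟩ ⟨e', he'⟩ := by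
        ext u
        show ((Equiv.swap e e' (u : Fin n) : Fin n) : ℕ) = _
        by_cases hu : u = ⟨e, he⟩
        · rw [hu, Equiv.swap_apply_left, Equiv.swap_apply_left]
        · by_cases hu' : u = ⟨e', he'⟩
          · rw [hu', Equiv.swap_apply_right, Equiv.swap_apply_right]
          · rw [Equiv.swap_apply_of_ne_of_ne hu hu', Equiv.swap_apply_of_ne_of_ne]
            · exact fun h => hu (Subtype.ext h)
            · exact fun h => hu' (Subtype.ext h)
      have hsum : ∑ u ∈ A, q.col u = 0 := by
        rw [← Finset.add_sum_erase A _ he, ← Finset.add_sum_erase (A.erase e) _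
          (Finset.mem_erase.mpr ⟨hne.symm, he'⟩), Finset.sum_eq_zero]
        · rw [hqc, hqc, if_pos rfl, if_neg hne.symm, if_pos rfl]; ring
        · intro u hu
          simp only [Finset.mem_erase] at hu
          rw [hqc, if_neg hu.2.1, if_neg hu.1]
      rw [psi_apply, hs, hsum, Equiv.Perm.sign_swap (fun h => hne (congrArg Subtype.val h))]
      simp
      norm_num
  · push Not at h1
    obtain ⟨e, he, h0⟩ := h1
    let q : WreathProduct r n := ⟨fun u => Multiplicative.ofAdd (if u = e then 1 else 0), 1⟩
    have hqc : ∀ u, q.col u = if u = e then 1 else 0 := fun u => rfl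
    have hq : q ∈ HA r A := fun u => Iff.rfl
    refine ⟨⟨q, hq⟩, ?_, ?_⟩
    · funext u
      show cshift (q.col u) (f u) = f u
      rw [hqc]
      split_ifs with hu
      · subst hu
        refine Prod.ext rfl ?_
        simp [cshift, h0]
      · exact cshift_zero _
    · have hs : HA.res (⟨q, hq⟩ : HA r A) = 1 := by ext u; rfl
      have hsum : ∑ u ∈ A, q.col u = 1 := by
        simp only [hqc]
        simp [he]
      rw [psi_apply, hs, hsum]
      simp only [Equiv.Perm.sign_one, Units.val_one, Int.cast_one, one_mul]
      intro h
      have : (1 : ZMod r) = 0 := ZMod.injective_stdAddChar (by rw [h, AddChar.map_zero_eq_one])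
      have : Fact (1 < r) := ⟨hr⟩
      exact one_ne_zero ‹(1 : ZMod r) = 0›

open Classical in
/-- the weight of a configuration -/
noncomputable def wt {r n : ℕ} (A : Finset (Fin n)) (f : Cfg r n) : ℕ :=
  if good A f then Nat.card {h : HA r A // (h : WreathProduct r n) • f = f} else 0

open Classical in
noncomputable instance {r n : ℕ} [NeZero r] (A : Finset (Fin n)) : Fintype (HA r A) :=
  Fintype.ofFinite _

theorem sum_psi {r n : ℕ} [NeZero r] (hr : 2 ≤ r) (A : Finset (Fin n)) (f : Cfg r n) :
    ∑ h : HA r A, (if (h : WreathProduct r n) • f = f then psi r A h else 0) = wt A f := by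
  classical
  rw [wt]
  split_ifs with hg
  · rw [Nat.card_eq_fintype_card, Fintype.card_subtype, Finset.card_filter, Nat.cast_sum]
    refine Finset.sum_congr rfl fun h _ => ?_
    split_ifs with hh
    · rw [good_psi hg h hh]; simp
    · simp
  · obtain ⟨q, hq, hq1⟩ := not_good hr hg
    set S := ∑ h : HA r A, (if (h : WreathProduct r n) • f = f then psi r A h else 0) with hS
    have : psi r A q * S = S := by
      rw [hS, Finset.mul_sum]
      refine Fintype.sum_equiv (Equiv.mulLeft q) _ _ fun h => ?_
      have : ((q * h : HA r A) : WreathProduct r n) • f = f ↔ (h : WreathProduct r n) • f = f := by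
        rw [Subgroup.coe_mul, mul_smul]
        constructor
        · intro h'
          exact (smul_left_cancel_iff _).mp (h'.trans hq.symm)
        · intro h'
          rw [h', hq]
      simp only [Equiv.coe_mulLeft, this, map_mul, mul_ite, mul_zero]
    have h2 : (psi r A q - 1) * S = 0 := by rw [sub_mul, this]; ring
    rcases mul_eq_zero.mp h2 with h | h
    · exact absurd (sub_eq_zero.mp h) hq1
    · rw [h]; simp

theorem L_chi {r n : ℕ} [NeZero r] (hr : 2 ≤ r) (A : Finset (Fin n)) (i : ℕ) :
    ∑ h : HA r A, ((r : ℂ) * i + 1) ^ (h : WreathProduct r n).len * psi r A h =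
      ((∑ f ∈ Om r n i, wt A f : ℕ) : ℂ) := by
  rw [Nat.cast_sum, Finset.sum_congr rfl fun f _ => (sum_psi hr A f).symm, Finset.sum_comm]
  refine Finset.sum_congr rfl fun h _ => ?_
  have h0 : ((r : ℂ) * i + 1) ^ (h : WreathProduct r n).len =
    (((r * i + 1) ^ (h : WreathProduct r n).len : ℕ) : ℂ) := by push_cast; rfl
  rw [h0, ← card_fixed, ← Finset.sum_filter, Finset.sum_const, nsmul_eq_mul]

theorem wt_zero {r n : ℕ} [NeZero r] (A : Finset (Fin n)) (i : ℕ) (hi : i < A.card) :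
    ∑ f ∈ Om r n i, wt A f = 0 := by
  refine Finset.sum_eq_zero fun f hf => ?_
  rw [wt, if_neg]
  rintro ⟨h1, h2⟩
  obtain ⟨x, hx, y, hy, hne, hxy⟩ := Finset.exists_ne_map_eq_of_card_lt_of_maps_to
    (s := A) (t := Finset.Icc 1 i) (f := fun e => (f e).1) (by simpa using hi) (by
      intro e he
      have := h1 e he
      have h3 := ((mem_Xs _).mp ((mem_Om f).mp hf e)).1
      simp only [Finset.coe_Icc, Set.mem_Icc]
      omega)
  exact hne (h2 x hx y hy hxy)

theorem wt_orbit {r n : ℕ} [NeZero r] (A : Finset (Fin n)) (f : Cfg r n) (hf : good A f) :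
    ∑ f' ∈ Finset.univ.image (fun h : HA r A => (h : WreathProduct r n) • f), wt A f' =
      Nat.card (HA r A) := by
  classical
  have h1 : ∀ f' ∈ Finset.univ.image (fun h : HA r A => (h : WreathProduct r n) • f),
      wt A f' = Nat.card (MulAction.stabilizer (HA r A) f) := by
    intro f' hf'
    simp only [Finset.mem_image, Finset.mem_univ, true_and] at hf'
    obtain ⟨h, rfl⟩ := hf'
    rw [wt, if_pos (good_smul hf h)]
    have e := MulAction.stabilizerEquivStabilizerOfOrbitRel (G := HA r A)
      (a := f) (b := h • f) (MulAction.orbitRel_apply.mpr (by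
        rw [← inv_smul_smul h f]
        simp only [smul_inv_smul, inv_smul_smul]
        exact (MulAction.mem_orbit_symm).mp (MulAction.mem_orbit f h)))
    exact (Nat.card_congr e.toEquiv).symm
  rw [Finset.sum_congr rfl h1, Finset.sum_const, smul_eq_mul]
  have : Fintype (MulAction.orbit (HA r A) f) := (Set.finite_range _).fintype
  haveI : Fintype (MulAction.stabilizer (HA r A) f) := Fintype.ofFinite _
  have h2 := MulAction.card_orbit_mul_card_stabilizer_eq_card_group (HA r A) f
  rw [Nat.card_eq_fintype_card, Nat.card_eq_fintype_card, ← h2]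
  congr 1
  rw [← Set.toFinset_card]
  congr 1
  ext f'
  simp only [Finset.mem_image, Finset.mem_univ, true_and, Set.mem_toFinset, MulAction.mem_orbit_iff]
  rfl

/-- each composition type contains a good configuration -/
theorem exists_good {r n : ℕ} [NeZero r] (A E : Finset (Fin n)) (hE : E.card = A.card) :
    ∃ v : WreathProduct r n, good A (v • bcfg r (ind E)) := by
  let e0 : {x // x ∈ A} ≃ {x // x ∈ E} := Finset.equivOfCardEq hE.symm
  let τ : Equiv.Perm (Fin n) := e0.extendSubtype
  have hτ : ∀ x ∈ A, τ x ∈ E := fun x hx => e0.extendSubtype_mem x hx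
  refine ⟨⟨1, τ⁻¹⟩, fun e he => ?_, fun e he e' he' h => ?_⟩
  · show lev (ind E) (τ⁻¹⁻¹ e) ≠ 0
    rw [inv_inv]
    intro h
    rw [lev_zero_iff] at h
    exact (ind_zero _ _).mp (h _ le_rfl) (hτ e he)
  · have h' : lev (ind E) (τ⁻¹⁻¹ e) = lev (ind E) (τ⁻¹⁻¹ e') := h
    rw [inv_inv] at h'
    apply τ.injective
    rcases lt_trichotomy (τ e) (τ e') with hl | hl | hl
    · rw [lev_eq_iff _ hl.le] at h'
      exact absurd (hτ e he) ((ind_zero _ _).mp (h' _ le_rfl hl))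
    · exact hl
    · rw [eq_comm, lev_eq_iff _ hl.le] at h'
      exact absurd (hτ e' he') ((ind_zero _ _).mp (h' _ le_rfl hl))

theorem card_G_le {r n : ℕ} [NeZero r] (A : Finset (Fin n)) :
    Nat.card (WreathProduct r n) ≤
      Nat.card (HA r A) * (Finset.univ.powersetCard A.card : Finset (Finset (Fin n))).card := by
  classical
  rw [Nat.card_eq_fintype_card, ← Finset.card_univ]
  refine Finset.card_le_mul_card_image_of_maps_to
    (f := fun w : WreathProduct r n => A.map w.right.toEmbedding) ?_ _ ?_
  · intro w _
    simp [Finset.mem_powersetCard]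
  · intro S _
    rcases Finset.eq_empty_or_nonempty
      (Finset.univ.filter (fun w : WreathProduct r n => A.map w.right.toEmbedding = S)) with h | ⟨w0, h0⟩
    · rw [h]; simp
    · rw [Nat.card_eq_fintype_card, ← Finset.card_univ (α := HA r A)]
      simp only [Finset.mem_filter, Finset.mem_univ, true_and] at h0
      have hm : ∀ w : WreathProduct r n, A.map w.right.toEmbedding = S → w0⁻¹ * w ∈ HA r A := by
        intro w hw e
        have h1 : ∀ u : WreathProduct r n, A.map u.right.toEmbedding = S →
            ∀ x, u.right x ∈ S ↔ x ∈ A := by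
          intro u hu x
          rw [← hu]; simp
        rw [SemidirectProduct.mul_right, Equiv.Perm.mul_apply, SemidirectProduct.inv_right,
          ← h1 w0 h0, ← h1 w hw]
        simp
      refine Finset.card_le_card_of_injOn
        (fun w => if h : A.map w.right.toEmbedding = S then ⟨w0⁻¹ * w, hm w h⟩ else 1) ?_ ?_
      · intro w _; simp
      · intro w hw w' hw' h
        simp only [Finset.coe_filter, Finset.mem_univ, true_and, Set.mem_ofPred_eq] at hw hw'
        simp only [hw, hw', dif_pos] at h
        exact mul_left_cancel (congrArg Subtype.val h)

theorem wt_ge {r n : ℕ} [NeZero r] (A : Finset (Fin n)) :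
    Nat.card (WreathProduct r n) ≤ ∑ f ∈ Om r n A.card, wt A f := by
  classical
  refine (card_G_le A).trans ?_
  have hex : ∀ E : Finset (Fin n), ∃ v : WreathProduct r n,
      E.card = A.card → good A (v • bcfg r (ind E)) := by
    intro E
    by_cases h : E.card = A.card
    · obtain ⟨v, hv⟩ := exists_good (r := r) A E h
      exact ⟨v, fun _ => hv⟩
    · exact ⟨1, fun h' => absurd h' h⟩
  choose v hv using hex
  let O : Finset (Fin n) → Finset (Cfg r n) := fun E =>
    Finset.univ.image (fun h : HA r A => (h : WreathProduct r n) • (v E • bcfg r (ind E)))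
  have hdisj : ∀ E ∈ Finset.univ.powersetCard A.card, ∀ E' ∈ Finset.univ.powersetCard A.card,
      E ≠ E' → Disjoint (O E) (O E') := by
    intro E _ E' _ hne
    rw [Finset.disjoint_left]
    intro f hf hf'
    simp only [O, Finset.mem_image, Finset.mem_univ, true_and] at hf hf'
    obtain ⟨h, rfl⟩ := hf
    obtain ⟨h', hh⟩ := hf'
    rw [← mul_smul, ← mul_smul] at hh
    have := base_unique _ _ _ _ hh
    apply hne
    ext t
    have h3 := congrFun this t
    rw [← not_iff_not, ← ind_zero, ← ind_zero, h3]
  have hsub : (Finset.univ.powersetCard A.card).biUnion O ⊆ Om r n A.card := by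
    intro f hf
    simp only [O, Finset.mem_biUnion, Finset.mem_image, Finset.mem_univ, true_and] at hf
    obtain ⟨E, hE, h, rfl⟩ := hf
    rw [← mul_smul]
    apply base_mem_Om
    rw [mem_Ds, sum_ind]
    exact ⟨(Finset.mem_powersetCard.mp hE).2.le, by simp⟩
  refine le_trans (le_of_eq ?_) (Finset.sum_le_sum_of_subset hsub)
  rw [Finset.sum_biUnion hdisj, mul_comm, ← smul_eq_mul, ← Finset.sum_const]
  refine Finset.sum_congr rfl fun E hE => ?_
  exact (wt_orbit A _ (hv E (Finset.mem_powersetCard.mp hE).2)).symm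

set_option linter.unusedSimpArgs false

theorem stab_univ (r n : ℕ) :
    MulAction.stabilizer (WreathProduct r n) (bcfg r (ind (Finset.univ : Finset (Fin n)))) = ⊥ := by
  rw [eq_bot_iff]
  intro p hp
  rw [mem_stab_bcfg] at hp
  obtain ⟨h1, h2⟩ := hp
  have hne : ∀ e : Fin n, lev (ind (Finset.univ : Finset (Fin n))) e ≠ 0 := by
    intro e h
    rw [lev_zero_iff] at h
    have := h e le_rfl
    simp [ind] at this
  have hlt : ∀ e e' : Fin n, e < e' → lev (ind (Finset.univ : Finset (Fin n))) e ≠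
      lev (ind (Finset.univ : Finset (Fin n))) e' := by
    intro e e' hl h
    rw [lev_eq_iff _ hl.le] at h
    have := h e le_rfl hl
    simp [ind] at this
  rw [Subgroup.mem_bot]
  refine SemidirectProduct.ext ?_ ?_
  · funext e
    exact h2 e (hne e)
  · refine Equiv.ext fun e => ?_
    show p.right e = e
    rcases lt_trichotomy (p.right e) e with h | h | h
    · exact absurd (h1 e) (hlt _ _ h)
    · exact h
    · exact absurd (h1 e).symm (hlt _ _ h)

theorem beta_sum {r n : ℕ} [NeZero r] (β : Finset (Fin n) → WreathProduct r n → ℂ)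
    (hβ : ∀ D g, (Nat.card (MulAction.stabilizer (WreathProduct r n) (bcfg r (ind D))) : ℂ) *
      ∑ E ∈ D.powerset, β E g =
        (Nat.card {v : WreathProduct r n //
          v⁻¹ * g * v ∈ MulAction.stabilizer (WreathProduct r n) (bcfg r (ind D))} : ℂ))
    (g : WreathProduct r n) :
    ∑ E, β E g = if g = 1 then (Nat.card (WreathProduct r n) : ℂ) else 0 := by
  have h := hβ Finset.univ g
  rw [stab_univ, Finset.powerset_univ] at h
  simp only [Subgroup.mem_bot, Nat.card_unique, Nat.cast_one, one_mul] at h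
  rw [h]
  have hiff : ∀ v : WreathProduct r n, v⁻¹ * g * v = 1 ↔ g = 1 := by
    intro v
    rw [mul_eq_one_iff_eq_inv, mul_eq_left]
  simp only [hiff]
  split_ifs with hg
  · simp only [hg]
    rw [Nat.card_congr (Equiv.subtypeUnivEquiv (fun _ => trivial))]
  · simp [hg]

theorem foulkes_fun_isCharacter {r n : ℕ} [NeZero r] (k : ℕ) :
    IsCharacter (WreathProduct r n) (foulkesChar r n k) := by
  obtain ⟨β, hc, hβ⟩ := wreath_descent_chars r n
  have : foulkesChar r n k = fun g => ∑ E ∈ Finset.univ.filter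
      (fun E : Finset (Fin n) => E.card = k), β E g := by
    funext g
    exact foulkes_eq β hβ k g
  rw [this]
  exact IsCharacter.sum _ _ (fun E _ => hc E)

theorem L_foulkes {r n : ℕ} [NeZero r] (hr : 2 ≤ r) (A : Finset (Fin n)) :
    ∑ h : HA r A, foulkesChar r n A.card h * psi r A h =
      ((∑ f ∈ Om r n A.card, wt A f : ℕ) : ℂ) := by
  have h1 : ∀ h : HA r A, foulkesChar r n A.card h * psi r A h =
      ∑ j ∈ Finset.range (A.card + 1), (-1 : ℂ) ^ j * ((n + 1).choose j : ℂ) *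
        (((r : ℂ) * (A.card - j : ℕ) + 1) ^ (h : WreathProduct r n).len * psi r A h) := by
    intro h
    rw [foulkesChar, Finset.sum_mul]
    exact Finset.sum_congr rfl fun j _ => by ring
  rw [Finset.sum_congr rfl fun h _ => h1 h, Finset.sum_comm]
  simp_rw [← Finset.mul_sum, L_chi hr]
  rw [Finset.sum_eq_single 0]
  · simp
  · intro j hj hj0
    rw [Finset.mem_range] at hj
    rw [wt_zero A _ (by omega)]
    simp
  · simp

theorem L_total {r n : ℕ} [NeZero r] (A : Finset (Fin n)) :
    ∑ k ∈ Finset.range (n + 1), ∑ h : HA r A, foulkesChar r n k h * psi r A h =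
      (Nat.card (WreathProduct r n) : ℂ) := by
  classical
  obtain ⟨β, hc, hβ⟩ := wreath_descent_chars r n
  rw [Finset.sum_comm]
  have h1 : ∀ h : HA r A, ∑ k ∈ Finset.range (n + 1), foulkesChar r n k h * psi r A h =
      if h = 1 then (Nat.card (WreathProduct r n) : ℂ) else 0 := by
    intro h
    rw [← Finset.sum_mul, Finset.sum_congr rfl fun k _ => foulkes_eq β hβ k h,
      Finset.sum_fiberwise_of_maps_to (fun E _ => by
        have := Finset.card_le_univ E
        simp only [Fintype.card_fin] at this
        exact Finset.mem_range.mpr (by omega)), beta_sum β hβ]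
    by_cases hh : h = 1
    · simp [hh]
    · have : (h : WreathProduct r n) ≠ 1 := fun h' => hh (Subtype.ext h')
      simp [hh, this]
  rw [Finset.sum_congr rfl fun h _ => h1 h]
  simp

theorem block_iff (r n : ℕ) (hr : 2 ≤ r) (a : ℕ → ℝ) :
    IsCharacter (WreathProduct r n)
        (fun w => ∑ k ∈ Finset.range (n + 1), (a k : ℂ) * foulkesChar r n k w)
      ↔ ∀ k ≤ n, 0 ≤ a k := by
  haveI : NeZero r := ⟨by omega⟩
  constructor
  · intro hch k hk
    obtain ⟨A, -, hA⟩ := Finset.exists_subset_card_eq (s := (Finset.univ : Finset (Fin n)))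
      (n := k) (by simpa using hk)
    have hN := fun j => (foulkes_fun_isCharacter (r := r) (n := n) j).mult_nonneg (HA r A) (psi r A)
    choose N hN0 hN using hN
    have htot : ∑ j ∈ Finset.range (n + 1), N j = (Nat.card (WreathProduct r n) : ℝ) := by
      have := L_total (r := r) A
      simp only [hN] at this
      exact_mod_cast this
    have hk1 : (Nat.card (WreathProduct r n) : ℝ) ≤ N k := by
      have h1 := L_foulkes hr A
      rw [hN, hA] at h1
      have h2 : N k = ((∑ f ∈ Om r n k, wt A f : ℕ) : ℝ) := by exact_mod_cast h1
      have h3 := wt_ge (r := r) A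
      rw [hA] at h3
      rw [h2]
      exact_mod_cast h3
    have hmem : k ∈ Finset.range (n + 1) := Finset.mem_range.mpr (by omega)
    have hsplit := Finset.add_sum_erase _ N hmem
    have hpos : 0 ≤ ∑ j ∈ (Finset.range (n + 1)).erase k, N j :=
      Finset.sum_nonneg fun j _ => hN0 j
    have hz : ∑ j ∈ (Finset.range (n + 1)).erase k, N j = 0 := by linarith
    rw [Finset.sum_eq_zero_iff_of_nonneg (fun j _ => hN0 j)] at hz
    obtain ⟨M, hM0, hM⟩ := hch.mult_nonneg (HA r A) (psi r A)
    have hM' : ∑ j ∈ Finset.range (n + 1), a j * N j = M := by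
      have h1 : ∑ j ∈ Finset.range (n + 1), (a j : ℂ) * (N j : ℂ) = (M : ℂ) := by
        rw [← hM]
        simp only [← hN, Finset.mul_sum, Finset.sum_mul]
        rw [Finset.sum_comm]
        exact Finset.sum_congr rfl fun _ _ => Finset.sum_congr rfl fun _ _ => by ring
      exact_mod_cast h1
    rw [Finset.sum_eq_single k (fun j hj hjk => by
      rw [hz j (Finset.mem_erase.mpr ⟨hjk, hj⟩), mul_zero]) (fun h => absurd hmem h)] at hM'
    have hcard : (0 : ℝ) < Nat.card (WreathProduct r n) := by exact_mod_cast Nat.card_pos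
    have : 0 < N k := by linarith
    by_contra hneg
    push Not at hneg
    have := mul_neg_of_neg_of_pos hneg this
    linarith
  · intro ha
    exact IsCharacter.sum _ _ (fun k hk =>
      (foulkes_fun_isCharacter k).smul (a k) (ha k (by have := Finset.mem_range.mp hk; omega)))

/-- A block function `φ = ∑_{k=0}^n φ_k·φ^n_k` on `W_{r,n}`, expanded in the
Foulkes characters, is a character if and only if `φ_k ≥ 0` for all
`k = 0, …, n`. -/
theorem blockFunction_isCharacter_iff (r n : ℕ) (hr : 2 ≤ r) (a : ℕ → ℝ) :
    IsCharacter (WreathProduct r n)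
        (fun w => ∑ k ∈ Finset.range (n + 1), (a k : ℂ) * foulkesChar r n k w)
      ↔ ∀ k ≤ n, 0 ≤ a k := by
  exact block_iff r n hr a
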